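/- arXiv:2503.06020 — 3 statements merged into one kernel-verified Lean document; each statement's English description precedes it below -/
import Mathlib

section
/- Suppose f is of Allee type (f_A) and δ ∈ (θ*_f, 1). Let (u,g,h) be a classical solution of the free boundary problem (a) with initial datum u₀ ∈ X(h₀) on [0,∞). Then there exists T₀ > 0 such that u(t,x) ≥ δ for all t ≥ T₀ and all x ∈ [g(t), h(t)]. -/
open Set Filter

/-- A function `f` is of Allee type `(f_A)` with distinguished zero `θ ∈ [0,1)`. -/
def AlleeType (f : ℝ → ℝ) (θ : ℝ) : Prop :=
  ContDiffOn ℝ 1 f (Ici (0:ℝ)) ∧ θ ∈ Ico (0:ℝ) 1 ∧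
    f 0 = 0 ∧ f θ = 0 ∧ f 1 = 0 ∧
    derivWithin f (Ici (0:ℝ)) 0 ≤ 0 ∧ derivWithin f (Ici (0:ℝ)) 1 < 0 ∧
    (∀ u ∈ Icc (0:ℝ) θ, f u ≤ 0) ∧ (∀ u ∈ Ioo θ (1:ℝ), 0 < f u) ∧
    (∀ u ∈ Ioi (1:ℝ), f u < 0) ∧ 0 < ∫ s in (0:ℝ)..1, f s

/-- `θs` is the number `θ*_f ∈ [θ,1)` attached to an Allee type `f`. -/
def IsThetaStar (f : ℝ → ℝ) (θ θs : ℝ) : Prop :=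
  θs ∈ Ico θ (1:ℝ) ∧ (∫ s in (0:ℝ)..θs, f s) = 0 ∧
    ∀ u ∈ Ioc θs (1:ℝ), 0 < ∫ s in (0:ℝ)..u, f s

/-- Membership in the initial class `X(h₀)`. -/
def InX (δ h₀ : ℝ) (φ : ℝ → ℝ) : Prop :=
  ContDiffOn ℝ 2 φ (Icc (-h₀) h₀) ∧ φ (-h₀) = δ ∧ φ h₀ = δ ∧
    ∀ x ∈ Icc (-h₀) h₀, 0 < φ x

/-- A classical solution `(u,g,h)` of the free boundary problem (with reaction
term `f = f(t,x,u)`) with initial datum `u₀ ∈ X(h₀)` on the time interval `I`. -/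
structure ClassicalSolution (d δ h₀ : ℝ) (f : ℝ → ℝ → ℝ → ℝ) (u₀ : ℝ → ℝ)
    (I : Set ℝ) (u : ℝ → ℝ → ℝ) (g h : ℝ → ℝ) : Prop where
  g_reg : ContDiffOn ℝ 1 g I
  h_reg : ContDiffOn ℝ 1 h I
  g_lt_h : ∀ t ∈ I, g t < h t
  u_cont : ContinuousOn (fun p : ℝ × ℝ => u p.1 p.2)
      {p : ℝ × ℝ | p.1 ∈ I ∧ p.2 ∈ Icc (g p.1) (h p.1)}
  ux_cont : ContinuousOn (fun p : ℝ × ℝ => deriv (u p.1) p.2)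
      {p : ℝ × ℝ | p.1 ∈ I ∧ 0 < p.1 ∧ p.2 ∈ Icc (g p.1) (h p.1)}
  ut_diff : ∀ t ∈ I, 0 < t → ∀ x ∈ Ioo (g t) (h t),
      DifferentiableAt ℝ (fun s => u s x) t
  ux_diff : ∀ t ∈ I, 0 < t → ∀ x ∈ Icc (g t) (h t), DifferentiableAt ℝ (u t) x
  uxx_diff : ∀ t ∈ I, 0 < t → ∀ x ∈ Ioo (g t) (h t),
      DifferentiableAt ℝ (deriv (u t)) x
  ut_cont : ContinuousOn (fun p : ℝ × ℝ => deriv (fun s => u s p.2) p.1)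
      {p : ℝ × ℝ | p.1 ∈ I ∧ 0 < p.1 ∧ p.2 ∈ Ioo (g p.1) (h p.1)}
  uxx_cont : ContinuousOn (fun p : ℝ × ℝ => deriv (deriv (u p.1)) p.2)
      {p : ℝ × ℝ | p.1 ∈ I ∧ 0 < p.1 ∧ p.2 ∈ Ioo (g p.1) (h p.1)}
  pde : ∀ t ∈ I, 0 < t → ∀ x ∈ Ioo (g t) (h t),
      deriv (fun s => u s x) t = d * deriv (deriv (u t)) x + f t x (u t x)
  bc_g : ∀ t ∈ I, 0 < t → u t (g t) = δ
  bc_h : ∀ t ∈ I, 0 < t → u t (h t) = δ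
  stefan_g : ∀ t ∈ I, 0 < t → deriv g t = -(d / δ) * deriv (u t) (g t)
  stefan_h : ∀ t ∈ I, 0 < t → deriv h t = -(d / δ) * deriv (u t) (h t)
  g_init : g 0 = -h₀
  h_init : h 0 = h₀
  u_init : ∀ x ∈ Icc (-h₀) h₀, u 0 x = u₀ x

/-- A semi-wave pair `(c,q)` for `(f, δ, d)`. -/
def SemiWavePair (d δ : ℝ) (f : ℝ → ℝ) (c : ℝ) (q : ℝ → ℝ) : Prop :=
  0 < c ∧ ContDiffOn ℝ 2 q (Ici (0:ℝ)) ∧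
    (∀ z ∈ Ici (0:ℝ),
      d * derivWithin (derivWithin q (Ici (0:ℝ))) (Ici (0:ℝ)) z
        - c * derivWithin q (Ici (0:ℝ)) z + f (q z) = 0) ∧
    (∀ z ∈ Ioi (0:ℝ), 0 < q z) ∧ q 0 = δ ∧
    Tendsto q atTop (nhds 1) ∧
    derivWithin q (Ici (0:ℝ)) 0 = c * δ / d ∧
    ∀ z ∈ Ici (0:ℝ), 0 < derivWithin q (Ici (0:ℝ)) z

/-- Condition `(f2)` with Hölder exponent `β`. -/
def CondF2 (f : ℝ → ℝ → ℝ → ℝ) (β : ℝ) : Prop :=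
  β ∈ Ioo (0:ℝ) 1 ∧
    (∀ M > 0, ∃ C > 0, ∀ t₁ ∈ Ici (0:ℝ), ∀ t₂ ∈ Ici (0:ℝ), ∀ x₁ x₂ : ℝ,
        ∀ v ∈ Icc (0:ℝ) M,
        |f t₁ x₁ v - f t₂ x₂ v| ≤ C * (|t₁ - t₂| ^ (β / 2) + |x₁ - x₂| ^ β)) ∧
    (∀ t ∈ Ici (0:ℝ), ∀ x : ℝ, ContDiffOn ℝ 1 (f t x) (Ici (0:ℝ))) ∧
    (∀ t ∈ Ici (0:ℝ), ∀ x : ℝ, f t x 0 = 0) ∧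
    (∀ M > 0, ∃ L > 0, ∀ t ∈ Ici (0:ℝ), ∀ x : ℝ,
        ∀ v₁ ∈ Icc (0:ℝ) M, ∀ v₂ ∈ Icc (0:ℝ) M,
        |f t x v₁ - f t x v₂| ≤ L * |v₁ - v₂|)

/-- Condition `(f3)` with constant `M₀`. -/
def CondF3 (f : ℝ → ℝ → ℝ → ℝ) (M₀ : ℝ) : Prop :=
  0 < M₀ ∧ ∀ t ∈ Ici (0:ℝ), ∀ x : ℝ, ∀ v, M₀ ≤ v → f t x v < 0

/-- Part (i) of condition `(f4)`, with upper bound function `fbar`. -/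
def CondF4i (f : ℝ → ℝ → ℝ → ℝ) (fbar : ℝ → ℝ) (β : ℝ) : Prop :=
  CondF2 f β ∧ (∀ t ∈ Ici (0:ℝ), ∀ x : ℝ, f t x 1 = 0) ∧
    ContinuousOn fbar (Ici (1:ℝ)) ∧
    ∀ t ∈ Ici (0:ℝ), ∀ x : ℝ, ∀ v, 1 < v → f t x v ≤ fbar v ∧ fbar v < 0

/-- Condition `(f4)`, with bounds `fbar` (above, for `u > 1`) and
`funder` (below, of Allee type). -/
def CondF4 (f : ℝ → ℝ → ℝ → ℝ) (fbar funder : ℝ → ℝ) (θ β : ℝ) : Prop :=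
  CondF4i f fbar β ∧ AlleeType funder θ ∧
    ∀ t ∈ Ici (0:ℝ), ∀ x : ℝ, ∀ v, 0 ≤ v → funder v ≤ f t x v

/-- Combustion-type nonlinearity `(f_c)` with ignition value `θ`. -/
def CombustionType (f : ℝ → ℝ) (θ : ℝ) : Prop :=
  ContDiffOn ℝ 1 f (Ici (0:ℝ)) ∧ θ ∈ Ioo (0:ℝ) 1 ∧
    (∀ u ∈ Icc (0:ℝ) θ, f u = 0) ∧ f 1 = 0 ∧ derivWithin f (Ici (0:ℝ)) 1 < 0 ∧
    (∀ u ∈ Ioo θ (1:ℝ), 0 < f u) ∧ (∀ u ∈ Ioi (1:ℝ), f u < 0)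

/-- The (unnormalised) bistable condition `(F_b)` with constants `0 < P < Q`. -/
def CondFb (F : ℝ → ℝ) (P Q : ℝ) : Prop :=
  0 < P ∧ P < Q ∧ ContDiffOn ℝ 1 F (Ici (0:ℝ)) ∧
    F 0 = 0 ∧ F P = 0 ∧ F Q = 0 ∧
    derivWithin F (Ici (0:ℝ)) 0 < 0 ∧ derivWithin F (Ici (0:ℝ)) Q < 0 ∧
    (∀ u ∈ Ioo (0:ℝ) P, F u < 0) ∧ (∀ u ∈ Ioi Q, F u < 0) ∧
    (∀ u ∈ Ioo P Q, 0 < F u) ∧ 0 < ∫ s in (0:ℝ)..Q, F s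

open Topology

lemma aux_second_deriv {φ φ' : ℝ → ℝ} {x φ'' : ℝ}
    (h1 : ∀ᶠ y in 𝓝 x, HasDerivAt φ (φ' y) y) (h2 : HasDerivAt φ' φ'' x)
    (hmin : IsLocalMin φ x) : 0 ≤ φ'' := by
  by_contra hneg
  push Not at hneg
  have he : deriv φ =ᶠ[𝓝 x] φ' := h1.mono fun y hy => hy.deriv
  have hdd : deriv (deriv φ) x = φ'' := by rw [he.deriv_eq]; exact h2.deriv
  have hmax : IsLocalMax φ x := by
    apply isLocalMax_of_deriv_deriv_neg
    · rw [hdd]; exact hneg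
    · exact hmin.deriv_eq_zero
    · exact h1.self_of_nhds.continuousAt
  have hc : φ =ᶠ[𝓝 x] fun _ => φ x := by
    filter_upwards [hmin, hmax] with y a b
    exact le_antisymm b a
  have h0 : deriv φ =ᶠ[𝓝 x] fun _ => 0 := by
    have := hc.deriv
    simpa using this
  have : deriv (deriv φ) x = 0 := by rw [h0.deriv_eq]; simp
  linarith

lemma aux_time_deriv {φ : ℝ → ℝ} {t a : ℝ} (h1 : HasDerivAt φ a t) (h0 : φ t = 0)
    (hs : ∀ᶠ s in 𝓝[<] t, 0 ≤ φ s) : a ≤ 0 := by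
  have h2 := (hasDerivAt_iff_tendsto_slope_left_right.1 h1).1
  refine le_of_tendsto h2 ?_
  filter_upwards [hs, self_mem_nhdsWithin] with s hs1 hs2
  rw [slope_def_field, h0]
  have : s < t := hs2
  apply div_nonpos_of_nonneg_of_nonpos <;> linarith

/-- First touching point. -/
lemma aux_touch {g h : ℝ → ℝ} {v : ℝ → ℝ → ℝ}
    (hg : ContinuousOn g (Ici 0)) (hh : ContinuousOn h (Ici 0))
    (hgh : ∀ t ∈ Ici (0:ℝ), g t < h t)
    (hv : ContinuousOn (fun p : ℝ × ℝ => v p.1 p.2)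
      {p : ℝ × ℝ | p.1 ∈ Ici (0:ℝ) ∧ p.2 ∈ Icc (g p.1) (h p.1)})
    (h0 : ∀ x ∈ Icc (g 0) (h 0), 0 < v 0 x)
    (hvg : ∀ t > 0, 0 < v t (g t)) (hvh : ∀ t > 0, 0 < v t (h t))
    {T X : ℝ} (hT : 0 ≤ T) (hX : X ∈ Icc (g T) (h T)) (hbad : v T X ≤ 0) :
    ∃ t > 0, ∃ x ∈ Ioo (g t) (h t), v t x = 0 ∧
      (∀ᶠ s in 𝓝[<] t, 0 ≤ v s x) ∧ ∀ᶠ y in 𝓝 x, 0 ≤ v t y := by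
  set Ω : Set (ℝ × ℝ) := {p : ℝ × ℝ | p.1 ∈ Ici (0:ℝ) ∧ p.2 ∈ Icc (g p.1) (h p.1)} with hΩ
  set Φ : ℝ × ℝ → ℝ × ℝ := fun q => (q.1, g q.1 + q.2 * (h q.1 - g q.1)) with hΦ
  have hΦc : ContinuousOn Φ (Icc (0:ℝ) T ×ˢ Icc (0:ℝ) 1) := by
    have m : MapsTo (fun q : ℝ × ℝ => q.1) (Icc (0:ℝ) T ×ˢ Icc (0:ℝ) 1) (Ici 0) :=
      fun q hq => hq.1.1
    have g1 := hg.comp continuous_fst.continuousOn m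
    have h1 := hh.comp continuous_fst.continuousOn m
    exact continuous_fst.continuousOn.prodMk
      (g1.add (continuous_snd.continuousOn.mul (h1.sub g1)))
  have hcomp := (isCompact_Icc.prod isCompact_Icc).image_of_continuousOn hΦc
  set Γ := Φ '' (Icc (0:ℝ) T ×ˢ Icc (0:ℝ) 1) with hΓ
  have hmem : ∀ t x, 0 ≤ t → t ≤ T → x ∈ Icc (g t) (h t) → (t, x) ∈ Γ := by
    intro t x ht0 htT hx
    have hp : 0 < h t - g t := sub_pos.2 (hgh t ht0)
    refine ⟨(t, (x - g t) / (h t - g t)), ⟨⟨ht0, htT⟩, ?_, ?_⟩, ?_⟩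
    · exact div_nonneg (by linarith [hx.1]) hp.le
    · rw [div_le_one hp]; linarith [hx.2]
    · simp only [hΦ]
      congr 1
      field_simp
      ring
  have hΓΩ : ∀ p ∈ Γ, p ∈ Ω ∧ p.1 ≤ T := by
    rintro p ⟨⟨t, s⟩, ⟨⟨a, b⟩, c, e⟩, rfl⟩
    simp only at a b c e
    have hp : 0 < h t - g t := sub_pos.2 (hgh t a)
    refine ⟨⟨a, ?_, ?_⟩, b⟩ <;> simp only [hΦ] <;> nlinarith
  have hvΓ : ContinuousOn (fun p : ℝ × ℝ => v p.1 p.2) Γ := hv.mono fun p hp => (hΓΩ p hp).1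
  have hK : IsCompact (Γ ∩ (fun p : ℝ × ℝ => v p.1 p.2) ⁻¹' Iic 0) :=
    hcomp.of_isClosed_subset
      (hvΓ.preimage_isClosed_of_isClosed hcomp.isClosed isClosed_Iic) inter_subset_left
  obtain ⟨⟨t, x⟩, ⟨hp1, hp2⟩, hmin⟩ := hK.exists_isMinOn (f := fun p : ℝ × ℝ => p.1)
    ⟨(T, X), hmem T X hT le_rfl hX, hbad⟩ continuous_fst.continuousOn
  obtain ⟨⟨ht0, hx⟩, htT⟩ := hΓΩ _ hp1
  simp only [mem_Ici, mem_preimage, mem_Iic] at ht0 hx htT hp2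
  have hearly : ∀ s y, 0 ≤ s → s < t → y ∈ Icc (g s) (h s) → 0 < v s y := by
    intro s y hs0 hst hy
    by_contra hc
    push Not at hc
    have : t ≤ s := hmin (a := (s, y)) ⟨hmem s y hs0 (by linarith) hy, hc⟩
    linarith
  have htpos : 0 < t := by
    rcases ht0.lt_or_eq with h' | h'
    · exact h'
    · subst h'
      exact absurd (h0 x hx) (not_lt.2 hp2)
  have hxg : g t < x := by
    rcases hx.1.lt_or_eq with h' | h'
    · exact h'
    · subst h'
      exact absurd (hvg t htpos) (not_lt.2 hp2)
  have hxh : x < h t := by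
    rcases hx.2.lt_or_eq with h' | h'
    · exact h'
    · subst h'
      exact absurd (hvh t htpos) (not_lt.2 hp2)
  have hgt : ContinuousAt g t := hg.continuousAt (Ici_mem_nhds htpos)
  have hht : ContinuousAt h t := hh.continuousAt (Ici_mem_nhds htpos)
  have hin : ∀ y ∈ Ioo (g t) (h t), ∀ᶠ s in 𝓝 t, 0 ≤ s ∧ y ∈ Icc (g s) (h s) := by
    intro y hy
    filter_upwards [hgt.eventually_lt_const hy.1, hht.eventually_const_lt hy.2,
      lt_mem_nhds htpos] with s a b c
    exact ⟨c.le, a.le, b.le⟩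
  have hev : ∀ y ∈ Ioo (g t) (h t), ∀ᶠ s in 𝓝[<] t, 0 ≤ v s y := by
    intro y hy
    filter_upwards [nhdsWithin_le_nhds (hin y hy), self_mem_nhdsWithin] with s a b
    exact (hearly s y a.1 b a.2).le
  have hge : ∀ y ∈ Ioo (g t) (h t), 0 ≤ v t y := by
    intro y hy
    have hc : Tendsto (fun s => v s y) (𝓝[<] t) (𝓝 (v t y)) := by
      have h1 : ContinuousWithinAt (fun p : ℝ × ℝ => v p.1 p.2) Ω (t, y) :=
        hv (t, y) ⟨htpos.le, hy.1.le, hy.2.le⟩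
      have h2 : Tendsto (fun s : ℝ => (s, y)) (𝓝[<] t) (𝓝[Ω] (t, y)) := by
        refine tendsto_nhdsWithin_iff.2 ⟨?_, ?_⟩
        · exact (Continuous.tendsto (by fun_prop) t).mono_left nhdsWithin_le_nhds
        · filter_upwards [nhdsWithin_le_nhds (hin y hy)] with s a
          exact a
      exact h1.tendsto.comp h2
    exact ge_of_tendsto hc (hev y hy)
  refine ⟨t, htpos, x, ⟨hxg, hxh⟩, le_antisymm hp2 (hge x ⟨hxg, hxh⟩), hev x ⟨hxg, hxh⟩, ?_⟩
  filter_upwards [Ioo_mem_nhds hxg hxh] with y hy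
  exact hge y hy

/-- Strict comparison principle from below. -/
lemma aux_compare {d δ h₀ : ℝ} {f u₀ : ℝ → ℝ} {u : ℝ → ℝ → ℝ} {g h : ℝ → ℝ} (hd : 0 < d)
    (hsol : ClassicalSolution d δ h₀ (fun _ _ v => f v) u₀ (Ici (0:ℝ)) u g h)
    {φ : ℝ → ℝ → ℝ} (hφ : Continuous (fun p : ℝ × ℝ => φ p.1 p.2))
    (h0 : ∀ x ∈ Icc (-h₀) h₀, φ 0 x < u₀ x)
    (hδ : ∀ t > 0, ∀ x, φ t x < δ)
    (hsub : ∀ t > 0, ∀ x ∈ Ioo (g t) (h t), u t x = φ t x →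
      ∃ (φ' : ℝ → ℝ) (φt φxx : ℝ), HasDerivAt (fun s => φ s x) φt t ∧
        (∀ y, HasDerivAt (φ t) (φ' y) y) ∧ HasDerivAt φ' φxx x ∧
        φt < d * φxx + f (φ t x)) :
    ∀ t ≥ 0, ∀ x ∈ Icc (g t) (h t), φ t x < u t x := by
  intro T hT X hX
  by_contra hbad
  push Not at hbad
  obtain ⟨t, ht, x, hx, hz, hs, hy⟩ := aux_touch (v := fun t x => u t x - φ t x)
    hsol.g_reg.continuousOn hsol.h_reg.continuousOn hsol.g_lt_h
    (hsol.u_cont.sub hφ.continuousOn)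
    (by
      intro x hx
      rw [hsol.g_init, hsol.h_init] at hx
      simp only [hsol.u_init x hx]
      linarith [h0 x hx])
    (by
      intro t ht
      simp only [hsol.bc_g t ht.le ht]
      linarith [hδ t ht (g t)])
    (by
      intro t ht
      simp only [hsol.bc_h t ht.le ht]
      linarith [hδ t ht (h t)])
    hT hX (by simpa using hbad)
  obtain ⟨φ', φt, φxx, a1, a2, a3, a4⟩ := hsub t ht x hx (by linarith)
  have e1 := (hsol.ut_diff t ht.le ht x hx).hasDerivAt
  have e2 := aux_time_deriv (e1.sub a1) hz hs
  have e3 : 0 ≤ deriv (deriv (u t)) x - φxx := by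
    refine aux_second_deriv (φ := fun y => u t y - φ t y)
      (φ' := fun y => deriv (u t) y - φ' y) (x := x) ?_ ?_ ?_
    · filter_upwards [Ioo_mem_nhds hx.1 hx.2] with y hy
      exact (hsol.ux_diff t ht.le ht y ⟨hy.1.le, hy.2.le⟩).hasDerivAt.sub (a2 y)
    · exact (hsol.uxx_diff t ht.le ht x hx).hasDerivAt.sub a3
    · filter_upwards [hy] with y hy
      simp only [hz]
      exact hy
  have e4 := hsol.pde t ht.le ht x hx
  have e5 : u t x = φ t x := by linarith
  simp only [e5] at e4
  nlinarith

/-- Positivity. -/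
lemma aux_pos {d δ h₀ θ : ℝ} {f u₀ : ℝ → ℝ} {u : ℝ → ℝ → ℝ} {g h : ℝ → ℝ} (hd : 0 < d)
    (hh₀ : 0 < h₀) (hδ : 0 < δ) (hf : AlleeType f θ) (hu₀ : InX δ h₀ u₀)
    (hsol : ClassicalSolution d δ h₀ (fun _ _ v => f v) u₀ (Ici (0:ℝ)) u g h) :
    ∀ t ≥ 0, ∀ x ∈ Icc (g t) (h t), 0 < u t x := by
  obtain ⟨x₁, hx₁, hmin⟩ := isCompact_Icc.exists_isMinOn
    (nonempty_Icc.2 (by linarith : -h₀ ≤ h₀)) hu₀.1.continuousOn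
  have hm1 := hu₀.2.2.2 x₁ hx₁
  set m := min (u₀ x₁) δ / 2 with hm
  have hmin0 : 0 < min (u₀ x₁) δ := lt_min hm1 hδ
  have hm0 : 0 < m := by positivity
  have hmu : m < u₀ x₁ := by have := min_le_left (u₀ x₁) δ; linarith
  have hmδ : m < δ := by have := min_le_right (u₀ x₁) δ; linarith
  obtain ⟨K, hK⟩ := (hf.1.mono (Icc_subset_Ici_self : Icc 0 m ⊆ Ici (0:ℝ))).exists_lipschitzOnWith
    (by norm_num) (convex_Icc 0 m) isCompact_Icc
  have hexp : ∀ t ≥ 0, Real.exp (-(K + 1) * t) ≤ 1 := by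
    intro t ht
    rw [Real.exp_le_one_iff]
    have : 0 ≤ (K:ℝ) := K.2
    nlinarith
  have key := aux_compare hd hsol (φ := fun t _ => m * Real.exp (-(K + 1) * t))
    (by fun_prop)
    (by
      intro x hx
      have : u₀ x₁ ≤ u₀ x := hmin hx
      simp only [mul_zero, Real.exp_zero, mul_one]
      linarith)
    (by
      intro t ht x
      have := hexp t ht.le
      nlinarith)
    (by
      intro t ht x hx _
      have hE := Real.exp_pos (-(K + 1) * t)
      refine ⟨fun _ => 0, m * (Real.exp (-(K + 1) * t) * (-(K + 1) * 1)), 0, ?_, ?_, ?_, ?_⟩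
      · exact (((hasDerivAt_id t).const_mul (-((K:ℝ) + 1))).exp).const_mul m
      · intro y; exact hasDerivAt_const _ _
      · exact hasDerivAt_const _ _
      · have h1 := hexp t ht.le
        set E := Real.exp (-(K + 1) * t)
        have hmE : 0 < m * E := by positivity
        have := hK.dist_le_mul (m * E) ⟨hmE.le, by nlinarith⟩ 0 ⟨le_rfl, hm0.le⟩
        rw [Real.dist_eq, Real.dist_eq, hf.2.2.1, sub_zero, sub_zero, abs_of_pos hmE] at this
        have h2 := neg_abs_le (f (m * E))
        nlinarith)
  intro t ht x hx
  have := key t ht x hx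
  have hE := Real.exp_pos (-(K + 1) * t)
  have : 0 < m * Real.exp (-(K + 1) * t) := by positivity
  linarith


lemma aux_hump {d δ : ℝ} {k : ℝ → ℝ} (hd : 0 < d) (hδ : 0 < δ) (hk : Continuous k)
    (hpos : ∀ w, 0 ≤ w → w < δ → 0 < ∫ s in w..δ, k s) (hkδ : 0 < k δ) :
    ∃ (w w' : ℝ → ℝ) (L C ε : ℝ), 0 < ε ∧ 0 < L ∧ 0 < C ∧ w 0 = δ ∧ (∀ z, w z ≤ δ) ∧
      (∀ z, L ≤ |z| → w z ≤ 0) ∧ (∀ z, HasDerivAt w (w' z) z) ∧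
      (∀ z, 0 < w z → |w' z| ≤ C ∧ HasDerivAt w' (-(k (w z) - ε) / d) z) := by
  set A : ℝ → ℝ := fun p => ∫ s in (0:ℝ)..1, k (δ - p * s) with hA
  have hAc : Continuous A := by
    apply intervalIntegral.continuous_parametric_intervalIntegral_of_continuous' (by fun_prop)
  have hpA : ∀ p, p * A p = ∫ s in (δ - p)..δ, k s := by
    intro p
    simp [hA]
  have hA0 : A 0 = k δ := by simp [hA]
  have hApos : ∀ p ∈ Icc 0 δ, 0 < A p := by
    intro p hp
    rcases hp.1.eq_or_lt with h | h
    · rw [← h, hA0]; exact hkδ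
    · have := hpos (δ - p) (by linarith [hp.2]) (by linarith)
      rw [← hpA] at this
      exact pos_of_mul_pos_right this h.le
  obtain ⟨p₁, hp₁, hmin⟩ := isCompact_Icc.exists_isMinOn (nonempty_Icc.2 hδ.le) hAc.continuousOn
  obtain ⟨p₂, hp₂, hmax⟩ := isCompact_Icc.exists_isMaxOn (nonempty_Icc.2 hδ.le) hAc.continuousOn
  set ε := A p₁ / 2 with hε
  have hε0 : 0 < ε := half_pos (hApos p₁ hp₁)
  have hAε : ∀ p ∈ Icc 0 δ, 2 * ε ≤ A p := fun p hp => by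
    have : A p₁ ≤ A p := hmin hp
    linarith
  have hAM : ∀ p ∈ Icc 0 δ, A p ≤ A p₂ := fun p hp => hmax hp
  set B : ℝ → ℝ := fun y => √((A (min (y ^ 2) δ) - ε) / (2 * d)) with hB
  have hBc : Continuous B := by fun_prop
  have hmm : ∀ y : ℝ, min (y ^ 2) δ ∈ Icc 0 δ := fun y =>
    ⟨le_min (sq_nonneg y) hδ.le, min_le_right _ _⟩
  set b₀ := √(ε / (2 * d)) with hb₀
  set b₁ := √((A p₂ - ε) / (2 * d)) with hb₁
  have hb₀pos : 0 < b₀ := Real.sqrt_pos.2 (by positivity)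
  have hBb₀ : ∀ y, b₀ ≤ B y := fun y => by
    apply Real.sqrt_le_sqrt
    have := hAε _ (hmm y)
    gcongr
    linarith
  have hBb₁ : ∀ y, B y ≤ b₁ := fun y => by
    apply Real.sqrt_le_sqrt
    have := hAM _ (hmm y)
    gcongr
  have hBpos : ∀ y, 0 < B y := fun y => hb₀pos.trans_le (hBb₀ y)
  have hb₁pos : 0 < b₁ := (hBpos 0).trans_le (hBb₁ 0)
  have hBsq : ∀ y, B y ^ 2 = (A (min (y ^ 2) δ) - ε) / (2 * d) := fun y => by
    apply Real.sq_sqrt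
    have := hAε _ (hmm y)
    apply div_nonneg <;> linarith
  -- the inverse function
  set Y : ℝ → ℝ := fun y => ∫ s in (0:ℝ)..y, (B s)⁻¹ with hY
  have hBi : Continuous fun s => (B s)⁻¹ := hBc.inv₀ fun s => (hBpos s).ne'
  have hYd : ∀ y, HasDerivAt Y ((B y)⁻¹) y := fun y =>
    intervalIntegral.integral_hasDerivAt_right (hBi.intervalIntegrable _ _)
      (hBi.stronglyMeasurableAtFilter _ _) hBi.continuousAt
  have hY0 : Y 0 = 0 := by simp [hY]
  have hYmono : StrictMono Y := strictMono_of_deriv_pos fun y => by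
    rw [(hYd y).deriv]; exact inv_pos.2 (hBpos y)
  have hYlow : Monotone fun y => Y y - b₁⁻¹ * y := by
    have hder : ∀ y, HasDerivAt (fun y => Y y - b₁⁻¹ * y) ((B y)⁻¹ - b₁⁻¹ * 1) y := fun y =>
      (hYd y).sub ((hasDerivAt_id y).const_mul _)
    apply monotone_of_deriv_nonneg (fun y => (hder y).differentiableAt)
    intro y
    rw [(hder y).deriv]
    have := inv_anti₀ (hBpos y) (hBb₁ y)
    linarith
  have hYc : Continuous Y := continuous_iff_continuousAt.2 fun y => (hYd y).continuousAt
  have hb₁i : 0 < b₁⁻¹ := inv_pos.2 hb₁pos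
  have hYsurj : Function.Surjective Y := by
    apply hYc.surjective
    · refine tendsto_atTop_mono' atTop ?_ (tendsto_id.const_mul_atTop hb₁i)
      filter_upwards [eventually_ge_atTop 0] with y hy
      have := hYlow hy
      simp only [hY0, id] at this ⊢
      linarith
    · refine tendsto_atBot_mono' atBot ?_ (tendsto_id.const_mul_atBot hb₁i)
      filter_upwards [eventually_le_atBot 0] with y hy
      have := hYlow hy
      simp only [hY0, id] at this ⊢
      linarith
  set e := hYmono.orderIsoOfSurjective Y hYsurj with he
  set y : ℝ → ℝ := fun z => e.symm z with hy
  have hyc : Continuous y := e.symm.continuous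
  have hYy : ∀ z, Y (y z) = z := fun z => e.apply_symm_apply z
  have hy0 : y 0 = 0 := hYmono.injective (by rw [hYy, hY0])
  have hyd : ∀ z, HasDerivAt y (B (y z)) z := fun z => by
    have := HasDerivAt.of_local_left_inverse hyc.continuousAt (hYd (y z))
      (inv_ne_zero (hBpos _).ne') (Eventually.of_forall hYy)
    simpa using this
  have hymono : Monotone fun z => y z - b₀ * z := by
    have hder : ∀ z, HasDerivAt (fun z => y z - b₀ * z) (B (y z) - b₀ * 1) z := fun z =>
      (hyd z).sub ((hasDerivAt_id z).const_mul _)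
    apply monotone_of_deriv_nonneg (fun z => (hder z).differentiableAt)
    intro z
    rw [(hder z).deriv]
    linarith [hBb₀ (y z)]
  have hyabs : ∀ z, b₀ * |z| ≤ |y z| := by
    intro z
    rcases le_total 0 z with hz | hz
    · have := hymono hz
      simp only [hy0] at this
      rw [abs_of_nonneg hz]
      exact le_trans (by linarith) (le_abs_self _)
    · have := hymono hz
      simp only [hy0] at this
      rw [abs_of_nonpos hz]
      exact le_trans (by linarith) (neg_le_abs _)
  have hsδ : 0 < √δ := Real.sqrt_pos.2 hδ
  -- derivative of `y * B y`
  have hkd : ∀ v : ℝ, v ^ 2 < δ → HasDerivAt (fun v => v * B v) ((k (δ - v ^ 2) - ε) / (2 * d * B v)) v := by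
    have hposcase : ∀ v : ℝ, 0 < v → v ^ 2 < δ →
        HasDerivAt (fun v => v * B v) ((k (δ - v ^ 2) - ε) / (2 * d * B v)) v := by
      intro v hv hvδ
      set E : ℝ → ℝ := fun v => ((∫ s in (δ - v ^ 2)..δ, k s) - ε * v ^ 2) / (2 * d) with hE
      have hEd : HasDerivAt E ((2 * v * k (δ - v ^ 2) - ε * (2 * v)) / (2 * d)) v := by
        have i1 : HasDerivAt (fun a => ∫ s in a..δ, k s) (-k (δ - v ^ 2)) (δ - v ^ 2) :=
          intervalIntegral.integral_hasDerivAt_left (hk.intervalIntegrable _ _)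
            (hk.stronglyMeasurableAtFilter _ _) hk.continuousAt
        have i2 : HasDerivAt (fun v : ℝ => v ^ 2) (2 * v) v := by
          simpa using hasDerivAt_pow 2 v
        have i3 : HasDerivAt (fun v : ℝ => δ - v ^ 2) (-(2 * v)) v := i2.const_sub δ
        have i4 := (((i1.comp v i3).sub (i2.const_mul ε)).div_const (2 * d))
        refine i4.congr_deriv ?_
        ring
      have hEeq : ∀ v : ℝ, v ^ 2 < δ → E v = (v * B v) ^ 2 := by
        intro v hv
        rw [mul_pow, hBsq, min_eq_left hv.le, hE]
        simp only [← hpA]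
        ring
      have hne : E v ≠ 0 := by
        rw [hEeq v hvδ]
        have := hBpos v
        positivity
      have hs := hEd.sqrt hne
      have hvB : √(E v) = v * B v := by
        rw [hEeq v hvδ, Real.sqrt_sq (mul_pos hv (hBpos v)).le]
      rw [hvB] at hs
      have hev : (fun v => v * B v) =ᶠ[𝓝 v] fun v => √(E v) := by
        have c2 : ContinuousAt (fun v : ℝ => v ^ 2) v := by fun_prop
        filter_upwards [lt_mem_nhds hv, c2.eventually_lt_const hvδ] with a ha hb
        rw [hEeq a hb, Real.sqrt_sq (mul_pos ha (hBpos a)).le]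
      refine (hs.congr_of_eventuallyEq hev).congr_deriv ?_
      have := hBpos v
      field_simp
    intro v hvδ
    rcases lt_trichotomy v 0 with hv | hv | hv
    · have h1 := hposcase (-v) (by linarith) (by simpa using hvδ)
      have h2 := (h1.comp v (hasDerivAt_neg v)).neg
      have hBe : ∀ v, B (-v) = B v := fun v => by simp [hB]
      refine (h2.congr_of_eventuallyEq ?_).congr_deriv ?_
      · exact Eventually.of_forall fun a => by simp [hBe]
      · simp [hBe]
    · subst hv
      have hd0 : HasDerivAt (fun v => v * B v) (B 0) 0 := by
        rw [hasDerivAt_iff_tendsto_slope]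
        have : Tendsto B (𝓝[≠] 0) (𝓝 (B 0)) := hBc.continuousAt.tendsto.mono_left nhdsWithin_le_nhds
        refine this.congr' ?_
        filter_upwards [self_mem_nhdsWithin] with a ha
        have : a ≠ 0 := ha
        rw [slope_def_field]
        field_simp
        simp
      refine hd0.congr_deriv ?_
      have h1 := hBsq 0
      have h2 : min ((0:ℝ) ^ 2) δ = 0 := by simp [hδ.le]
      rw [h2, hA0] at h1
      have := hBpos 0
      field_simp at h1 ⊢
      simp
      linarith
    · exact hposcase v hv hvδ
  refine ⟨fun z => δ - y z ^ 2, fun z => -2 * (y z * B (y z)), √δ / b₀, 2 * (√δ * b₁), ε, hε0,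
    by positivity, by positivity, by simp [hy0], fun z => by nlinarith [sq_nonneg (y z)], ?_, ?_, ?_⟩
  · intro z hz
    have h1 : √δ ≤ |y z| := by
      rw [div_le_iff₀ hb₀pos] at hz
      linarith [hyabs z]
    have h2 : √δ ^ 2 ≤ |y z| ^ 2 := by gcongr
    rw [Real.sq_sqrt hδ.le, sq_abs] at h2
    linarith
  · intro z
    refine (((hyd z).pow 2).const_sub δ).congr_deriv ?_
    simp
    ring
  · intro z hz
    have hz' : y z ^ 2 < δ := by linarith
    refine ⟨?_, ?_⟩
    · have h1 : |y z| ≤ √δ := Real.abs_le_sqrt hz'.le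
      rw [abs_mul, abs_mul, abs_of_pos (hBpos (y z))]
      have h2 := hBb₁ (y z)
      have h3 := hBpos (y z)
      norm_num
      gcongr
    · refine (((hkd (y z) hz').comp z (hyd z)).const_mul (-2)).congr_deriv ?_
      have := hBpos (y z)
      field_simp

/-- eventually `u(t,x) ≥ δ` on the whole population range. -/
theorem eventually_ge_delta (d δ h₀ θ θs : ℝ) (f u₀ : ℝ → ℝ)
    (u : ℝ → ℝ → ℝ) (g h : ℝ → ℝ)
    (hd : 0 < d) (hh₀ : 0 < h₀)
    (hf : AlleeType f θ) (hθs : IsThetaStar f θ θs) (hδ : δ ∈ Ioo θs 1)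
    (hu₀ : InX δ h₀ u₀)
    (hsol : ClassicalSolution d δ h₀ (fun _ _ v => f v) u₀ (Ici (0:ℝ)) u g h) :
    ∃ T₀ > 0, ∀ t ≥ T₀, ∀ x ∈ Icc (g t) (h t), δ ≤ u t x := by
  have hθ := hf.2.1
  have hθθs : θ ≤ θs := hθs.1.1
  have hθδ : θ < δ := hθθs.trans_lt hδ.1
  have hδ0 : 0 < δ := hθ.1.trans_lt hθδ
  have hpos := aux_pos hd hh₀ hδ0 hf hu₀ hsol
  -- continuous extension of the nonlinearity
  set k : ℝ → ℝ := fun v => f (max 0 v) with hk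
  have hfc : ContinuousOn f (Ici 0) := hf.1.continuousOn
  have hkc : Continuous k :=
    hfc.comp_continuous (by fun_prop) fun v => mem_Ici.2 (le_max_left _ _)
  have hkf : ∀ v, 0 ≤ v → k v = f v := fun v hv => by simp [hk, hv]
  have hfpos := hf.2.2.2.2.2.2.2.2.1
  have hfneg := hf.2.2.2.2.2.2.2.1
  have hint : ∀ w, 0 ≤ w → w < δ → 0 < ∫ s in w..δ, k s := by
    intro w hw hwδ
    rcases le_or_gt θ w with hc | hc
    · apply intervalIntegral.intervalIntegral_pos_of_pos_on (hkc.intervalIntegrable _ _) _ hwδ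
      intro s hs
      rw [hkf s (by linarith [hs.1])]
      exact hfpos s ⟨by linarith [hs.1], by linarith [hs.2, hδ.2]⟩
    · have h1 : (∫ s in (0:ℝ)..δ, k s) = ∫ s in (0:ℝ)..δ, f s := by
        apply intervalIntegral.integral_congr
        intro s hs
        rw [uIcc_of_le hδ0.le] at hs
        exact hkf s hs.1
      have h2 : 0 < ∫ s in (0:ℝ)..δ, f s := hθs.2.2 δ ⟨hδ.1, hδ.2.le⟩
      have h3 : (∫ s in (0:ℝ)..w, k s) ≤ 0 := by
        have := intervalIntegral.integral_mono_on hw (hkc.intervalIntegrable (μ := MeasureTheory.volume) 0 w)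
          (intervalIntegrable_const (c := (0:ℝ))) (fun s hs => by
            rw [hkf s hs.1]
            exact hfneg s ⟨hs.1, by linarith [hs.2]⟩)
        simpa using this
      have h4 := intervalIntegral.integral_add_adjacent_intervals
        (hkc.intervalIntegrable 0 w) (hkc.intervalIntegrable (μ := MeasureTheory.volume) w δ)
      linarith
  obtain ⟨w, w', L, C, ε, hε, hL, hC, hw0, hwδ, hwL, hwd, hwdd⟩ :=
    aux_hump hd hδ0 hkc hint (by rw [hkf δ hδ0.le]; exact hfpos δ ⟨hθδ, hδ.2⟩)
  have hwc : Continuous w := continuous_iff_continuousAt.2 fun z => (hwd z).continuousAt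
  -- uniform continuity
  have huc := isCompact_Icc.uniformContinuousOn_of_continuous
    (hkc.continuousOn (s := Icc 0 δ))
  obtain ⟨η₀, hη₀, huc'⟩ := Metric.uniformContinuousOn_iff.1 huc (ε / 2) (by positivity)
  set c := ε / (2 * C) with hc
  have hc0 : 0 < c := by positivity
  have hcC : c * C = ε / 2 := by rw [hc]; field_simp
  have key : ∀ σ a : ℝ, |σ| ≤ c → (∀ x ∈ Icc (-h₀) h₀, L ≤ |x - a|) →
      ∀ t ≥ 0, ∀ x ∈ Icc (g t) (h t), w (x - σ * t - a) ≤ u t x := by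
    intro σ a hσ ha t ht x hx
    have hη : ∀ η, 0 < η → η < η₀ → w (x - σ * t - a) - η < u t x := by
      intro η hη1 hη2
      refine aux_compare hd hsol (φ := fun t x => w (x - σ * t - a) - η) ?_ ?_ ?_ ?_ t ht x hx
      · fun_prop
      · intro x hx
        have h1 := hwL (x - a) (ha x hx)
        have h2 := hu₀.2.2.2 x hx
        simp only [mul_zero, sub_zero]
        linarith
      · intro t ht x
        linarith [hwδ (x - σ * t - a)]
      · intro t ht x hx htouch
        have hup := hpos t ht.le x ⟨hx.1.le, hx.2.le⟩
        set z := x - σ * t - a with hz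
        have hwz : η < w z := by linarith
        obtain ⟨b1, b2⟩ := hwdd z (by linarith)
        refine ⟨fun y => w' (y - σ * t - a), w' z * (-σ), -(k (w z) - ε) / d, ?_, ?_, ?_, ?_⟩
        · have i1 : HasDerivAt (fun s => x - σ * s - a) (-σ) t := by
            have := (((hasDerivAt_id t).const_mul σ).const_sub x).sub_const a
            simpa using this
          exact ((hwd z).comp t i1).sub_const η
        · intro y
          have i1 : HasDerivAt (fun y => y - σ * t - a) 1 y :=
            ((hasDerivAt_id y).sub_const _).sub_const _
          simpa using ((hwd (y - σ * t - a)).comp y i1).sub_const η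
        · have i1 : HasDerivAt (fun y => y - σ * t - a) 1 x :=
            ((hasDerivAt_id x).sub_const _).sub_const _
          have := HasDerivAt.comp x (h := fun y => y - σ * t - a) b2 i1
          rw [mul_one] at this
          exact this
        · have h1 := huc' (w z) ⟨by linarith, hwδ z⟩ (w z - η) ⟨by linarith, by linarith [hwδ z]⟩
            (by rw [Real.dist_eq]; simpa [abs_of_pos hη1] using hη2)
          rw [Real.dist_eq, hkf (w z - η) (by linarith)] at h1
          have h2 := (abs_lt.1 h1).2
          have h3 : |w' z * (-σ)| ≤ ε / 2 := by
            rw [abs_mul, abs_neg, ← hcC, mul_comm c C]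
            gcongr
          have h4 := le_abs_self (w' z * (-σ))
          have h5 : d * (-(k (w z) - ε) / d) = -(k (w z) - ε) := by field_simp
          rw [h5]
          linarith
    by_contra hcon
    push Not at hcon
    have h1 := hη (min (η₀ / 2) (w (x - σ * t - a) - u t x))
      (lt_min (by positivity) (by linarith))
      ((min_le_left _ _).trans_lt (by linarith))
    have h2 := min_le_right (η₀ / 2) (w (x - σ * t - a) - u t x)
    linarith
  refine ⟨(h₀ + L) / c, by positivity, ?_⟩
  intro t ht x hx
  have ht0 : 0 ≤ t := le_trans (by positivity) ht
  have hct : h₀ + L ≤ c * t := by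
    have : (h₀ + L) / c ≤ t := ht
    rw [div_le_iff₀ hc0] at this
    linarith
  rcases le_total x 0 with hx0 | hx0
  · have := key c (x - c * t) (by rw [abs_of_pos hc0]) (by
      intro y hy
      exact le_trans (by linarith [hy.1]) (le_abs_self _)) t ht0 x hx
    simpa [hw0] using this
  · have := key (-c) (x + c * t) (by rw [abs_neg, abs_of_pos hc0]) (by
      intro y hy
      exact le_trans (by linarith [hy.2]) (neg_le_abs _)) t ht0 x hx
    have e : x - -c * t - (x + c * t) = 0 := by ring
    rwa [e, hw0] at this
end

section
/- Let d > 0 and let F satisfy condition (F_b) with constants 0 < P < Q. Then there exists a constant c* > 0 and a strictly increasing function φ ∈ C²(ℝ) such that d·φ''(x) − c*·φ'(x) + F(φ(x)) = 0 for all x ∈ ℝ, lim_{x→−∞} φ(x) = 0, and lim_{x→+∞} φ(x) = Q. -/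
open Set Filter

lemma tw_cmp {f f' B B' : ℝ → ℝ} {a b : ℝ}
    (hf : ∀ x ∈ Icc a b, HasDerivAt f (f' x) x) (hB : ∀ x ∈ Icc a b, HasDerivAt B (B' x) x)
    (ha : f a ≤ B a) (bound : ∀ x ∈ Ico a b, f' x ≤ B' x) : ∀ x ∈ Icc a b, f x ≤ B x := by
  intro x hx
  exact image_le_of_deriv_right_le_deriv_boundary
    (fun x hx => (hf x hx).continuousAt.continuousWithinAt)
    (fun x hx => (hf x (Ico_subset_Icc_self hx)).hasDerivWithinAt) ha
    (fun x hx => (hB x hx).continuousAt.continuousWithinAt)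
    (fun x hx => (hB x (Ico_subset_Icc_self hx)).hasDerivWithinAt) bound hx

lemma tw_cmp_lt {f f' B B' : ℝ → ℝ} {a b : ℝ}
    (hf : ∀ x ∈ Icc a b, HasDerivAt f (f' x) x) (hB : ∀ x ∈ Icc a b, HasDerivAt B (B' x) x)
    (ha : f a ≤ B a) (bound : ∀ x ∈ Ico a b, f x = B x → f' x < B' x) :
    ∀ x ∈ Icc a b, f x ≤ B x := by
  intro x hx
  exact image_le_of_deriv_right_lt_deriv_boundary'
    (fun x hx => (hf x hx).continuousAt.continuousWithinAt)
    (fun x hx => (hf x (Ico_subset_Icc_self hx)).hasDerivWithinAt) ha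
    (fun x hx => (hB x hx).continuousAt.continuousWithinAt)
    (fun x hx => (hB x (Ico_subset_Icc_self hx)).hasDerivWithinAt) bound hx

def TwSol (T : ℝ) (h g W : ℝ → ℝ) : Prop :=
  W 0 = 0 ∧ ∀ t ∈ Icc 0 T, HasDerivAt W (h t - g (W t)) t

lemma tw_stab_one {T η : ℝ} {h g₁ g₂ W₁ W₂ : ℝ → ℝ} (hη : 0 ≤ η) (hm : Monotone g₁)
    (s₁ : TwSol T h g₁ W₁) (s₂ : TwSol T h g₂ W₂) (hg : ∀ x, |g₁ x - g₂ x| ≤ η) :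
    ∀ t ∈ Icc 0 T, W₁ t - W₂ t ≤ η * t := by
  intro t ht
  refine le_of_forall_pos_le_add fun ε hε => ?_
  have hT : 0 ≤ T := ht.1.trans ht.2
  have key := tw_cmp_lt (a := 0) (b := T) (f := fun t => W₁ t - W₂ t)
    (B := fun t => (η + ε / (T + 1)) * t) (B' := fun _ => (η + ε / (T + 1)))
    (fun x hx => (s₁.2 x hx).sub (s₂.2 x hx))
    (fun x hx => by simpa using (hasDerivAt_id x).const_mul (η + ε / (T + 1)))
    (by simp [s₁.1, s₂.1]) (by
      intro x hx hxe
      have h1 : 0 ≤ (η + ε / (T + 1)) * x := mul_nonneg (by positivity) hx.1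
      have h2 : W₂ x ≤ W₁ x := by linarith
      have h3 := hm h2
      have h4 := (abs_le.1 (hg (W₂ x))).1
      have h5 : 0 < ε / (T + 1) := by positivity
      linarith) t ht
  have : ε / (T + 1) * t ≤ ε := by
    rw [div_mul_eq_mul_div, div_le_iff₀ (by positivity)]
    nlinarith [ht.2]
  linarith

lemma tw_stab {T η : ℝ} {h g₁ g₂ W₁ W₂ : ℝ → ℝ} (hη : 0 ≤ η) (hm₁ : Monotone g₁)
    (hm₂ : Monotone g₂)
    (s₁ : TwSol T h g₁ W₁) (s₂ : TwSol T h g₂ W₂) (hg : ∀ x, |g₁ x - g₂ x| ≤ η) :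
    ∀ t ∈ Icc 0 T, |W₁ t - W₂ t| ≤ η * t := by
  intro t ht
  rw [abs_le]
  have h1 := tw_stab_one hη hm₁ s₁ s₂ hg t ht
  have h2 := tw_stab_one hη hm₂ s₂ s₁ (fun x => by rw [abs_sub_comm]; exact hg x) t ht
  constructor <;> linarith

lemma tw_ext {T : ℝ} (hT : 0 ≤ T) {h g α : ℝ → ℝ} (hh : Continuous h) (hg : Continuous g)
    (hα : ContinuousOn α (Icc 0 T))
    (hi : ∀ t ∈ Icc 0 T, α t = ∫ s in (0:ℝ)..t, (h s - g (α s))) :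
    ∃ W, TwSol T h g W ∧ ∀ t ∈ Icc 0 T, W t = α t := by
  have hβ : Continuous (IccExtend hT ((Icc 0 T).domRestrict α)) :=
    (continuousOn_iff_continuous_domRestrict.1 hα).Icc_extend'
  set β := IccExtend hT ((Icc 0 T).domRestrict α) with hβd
  have hβe : ∀ t ∈ Icc 0 T, β t = α t := fun t ht => by
    rw [hβd, IccExtend_of_mem _ _ ht]; rfl
  have hW : ∀ t ∈ Icc 0 T, (∫ s in (0:ℝ)..t, (h s - g (β s))) = α t := by
    intro t ht
    rw [hi t ht]
    refine intervalIntegral.integral_congr fun s hs => ?_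
    rw [uIcc_of_le ht.1] at hs
    rw [hβe s ⟨hs.1, hs.2.trans ht.2⟩]
  refine ⟨fun t => ∫ s in (0:ℝ)..t, (h s - g (β s)), ⟨by simp, fun t ht => ?_⟩, hW⟩
  change HasDerivAt _ (h t - g (∫ s in (0:ℝ)..t, (h s - g (β s)))) t
  rw [hW t ht, ← hβe t ht]
  have hc : Continuous fun s => h s - g (β s) := hh.sub (hg.comp hβ)
  exact intervalIntegral.integral_hasDerivAt_right (hc.intervalIntegrable _ _)
    (hc.stronglyMeasurableAtFilter _ _) hc.continuousAt

lemma tw_lip {T B D : ℝ} (hT : 0 ≤ T) (hB : 0 ≤ B) (hD : 0 ≤ D) {h g : ℝ → ℝ} (hh : Continuous h)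
    (hhB : ∀ t, |h t| ≤ B) {K : NNReal} (hg : LipschitzWith K g) (hgD : ∀ x, |g x| ≤ D) :
    ∃ W, TwSol T h g W := by
  have hp : IsPicardLindelof (fun t x => h t - g x) (tmin := 0) (tmax := T) ⟨0, le_refl _, hT⟩
      (0:ℝ) ((B + D).toNNReal * T.toNNReal) 0 (B + D).toNNReal K := by
    constructor
    · intro t ht
      refine LipschitzWith.lipschitzOnWith ?_
      refine LipschitzWith.of_dist_le_mul fun x y => ?_
      have := hg.dist_le_mul x y
      rw [dist_sub_left]; exact this
    · intro x _
      exact (hh.sub continuous_const).continuousOn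
    · intro t _ x _
      rw [Real.coe_toNNReal _ (by positivity)]
      calc ‖h t - g x‖ ≤ |h t| + |g x| := abs_sub _ _
        _ ≤ B + D := add_le_add (hhB t) (hgD x)
    · simp [hT]
  obtain ⟨α, h0, hα⟩ := hp.exists_eq_forall_mem_Icc_hasDerivWithinAt (x := 0) (by simp)
  have hc : ContinuousOn α (Icc 0 T) := fun t ht => (hα t ht).continuousWithinAt
  obtain ⟨W, hW, -⟩ := tw_ext hT (h := h) (g := g) hh hg.continuous hc (fun t ht => by
    have hci : ContinuousOn (fun s => h s - g (α s)) (Icc 0 t) :=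
      hh.continuousOn.sub (hg.continuous.comp_continuousOn (hc.mono (Icc_subset_Icc_right ht.2)))
    have := intervalIntegral.integral_eq_sub_of_hasDeriv_right_of_le (f := α)
      (f' := fun s => h s - g (α s)) ht.1
      (hc.mono (Icc_subset_Icc_right ht.2))
      (fun x hx => ((hα x ⟨hx.1.le, hx.2.le.trans ht.2⟩).hasDerivAt
        (Icc_mem_nhds hx.1 (hx.2.trans_le ht.2))).hasDerivWithinAt)
      (hci.intervalIntegrable_of_Icc ht.1)
    rw [this]
    simp only at h0
    rw [h0, sub_zero])
  exact ⟨W, hW⟩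

noncomputable def twS (M ε w : ℝ) : ℝ := √(max 0 (min (2 * w) (2 * M)) + ε ^ 2)

lemma twS_mono (M ε : ℝ) : Monotone (twS M ε) := by
  intro x y hxy
  unfold twS
  gcongr

lemma twS_nonneg (M ε w : ℝ) : 0 ≤ twS M ε w := Real.sqrt_nonneg _

lemma twS_cont (M ε : ℝ) : Continuous (twS M ε) := by
  unfold twS; fun_prop

lemma twS_le (M ε w : ℝ) (hM : 0 ≤ M) : twS M ε w ≤ √(2 * M + ε ^ 2) := by
  unfold twS
  gcongr
  exact max_le (by positivity) (min_le_right _ _)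

lemma twS_eps_aux {M ε ε' : ℝ} (hε : 0 ≤ ε) (h : ε ≤ ε') (w : ℝ) :
    twS M ε' w ≤ twS M ε w + (ε' - ε) := by
  unfold twS
  set a := max 0 (min (2 * w) (2 * M)) with ha
  have ha0 : 0 ≤ a := le_max_left _ _
  have h1 : ε ≤ √(a + ε ^ 2) := Real.le_sqrt_of_sq_le (by linarith)
  have h2 : √(a + ε ^ 2) ^ 2 = a + ε ^ 2 := Real.sq_sqrt (by positivity)
  rw [Real.sqrt_le_left (by linarith)]
  nlinarith

lemma twS_eps_mono {M ε ε' : ℝ} (hε : 0 ≤ ε) (h : ε ≤ ε') (w : ℝ) :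
    twS M ε w ≤ twS M ε' w := by
  unfold twS; gcongr

lemma twS_eps {M ε ε' : ℝ} (hε : 0 ≤ ε) (hε' : 0 ≤ ε') (w : ℝ) :
    |twS M ε w - twS M ε' w| ≤ |ε - ε'| := by
  rcases le_total ε ε' with h | h
  · rw [abs_sub_comm, abs_sub_comm ε, abs_of_nonneg (sub_nonneg.2 h),
      abs_of_nonneg (sub_nonneg.2 (twS_eps_mono hε h w))]
    linarith [twS_eps_aux (M := M) hε h w]
  · rw [abs_of_nonneg (sub_nonneg.2 h),
      abs_of_nonneg (sub_nonneg.2 (twS_eps_mono hε' h w))]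
    linarith [twS_eps_aux (M := M) hε' h w]

lemma twS_lip {M ε : ℝ} (hε : 0 < ε) : LipschitzWith (1 / ε).toNNReal (twS M ε) := by
  refine LipschitzWith.of_le_add_mul _ fun x y => ?_
  rw [Real.coe_toNNReal _ (by positivity), Real.dist_eq]
  rcases le_total x y with h | h
  · have := twS_mono M ε h
    have : 0 ≤ 1 / ε * |x - y| := by positivity
    linarith
  · rw [abs_of_nonneg (sub_nonneg.2 h)]
    unfold twS
    have hab : max 0 (min (2 * x) (2 * M)) ≤ max 0 (min (2 * y) (2 * M)) + 2 * (x - y) := by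
      rcases max_cases 0 (min (2 * x) (2 * M)) with h1 | h1 <;>
      rcases max_cases 0 (min (2 * y) (2 * M)) with h2 | h2 <;>
      rcases min_cases (2 * x) (2 * M) with h3 | h3 <;>
      rcases min_cases (2 * y) (2 * M) with h4 | h4 <;> linarith
    set a := max 0 (min (2 * x) (2 * M))
    set b := max 0 (min (2 * y) (2 * M))
    have hb0 : 0 ≤ b := le_max_left _ _
    have h1 : ε ≤ √(b + ε ^ 2) := Real.le_sqrt_of_sq_le (by linarith)
    have h2 : √(b + ε ^ 2) ^ 2 = b + ε ^ 2 := Real.sq_sqrt (by positivity)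
    have hz : 0 ≤ 1 / ε * (x - y) := mul_nonneg (by positivity) (by linarith)
    have hz2 : ε * (1 / ε * (x - y)) = x - y := by field_simp
    rw [Real.sqrt_le_left (by linarith)]
    nlinarith


lemma tw_exist {T B M c : ℝ} (hT : 0 ≤ T) (hB : 0 ≤ B) (hM : 0 ≤ M) (hc : 0 ≤ c) {h : ℝ → ℝ}
    (hh : Continuous h) (hhB : ∀ t, |h t| ≤ B) :
    ∃ W, TwSol T h (fun w => c * twS M 0 w) W := by
  set e : ℕ → ℝ := fun n => 1 / ((n : ℝ) + 1) with he
  have he0 : ∀ n, 0 < e n := fun n => by simp only [he]; positivity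
  have he1 : ∀ n, e n ≤ 1 := fun n => by
    simp only [he]
    rw [div_le_one (by positivity)]
    have : (0:ℝ) ≤ n := by positivity
    linarith
  have hel : Tendsto e atTop (nhds 0) := tendsto_one_div_add_atTop_nhds_zero_nat
  have hmono : ∀ ε, Monotone (fun w => c * twS M ε w) := fun ε =>
    (twS_mono M ε).const_mul hc
  have hex : ∀ n, ∃ W, TwSol T h (fun w => c * twS M (e n) w) W := by
    intro n
    have hl : LipschitzWith (c.toNNReal * (1 / e n).toNNReal) (fun w => c * twS M (e n) w) := by
      refine LipschitzWith.of_dist_le_mul fun x y => ?_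
      have := (twS_lip (M := M) (he0 n)).dist_le_mul x y
      rw [Real.dist_eq, ← mul_sub, abs_mul, abs_of_nonneg hc, NNReal.coe_mul,
        Real.coe_toNNReal c hc, mul_assoc]
      rw [Real.dist_eq] at this
      gcongr
    refine tw_lip (D := c * √(2 * M + e n ^ 2)) hT hB (by positivity) hh hhB hl fun x => ?_
    rw [abs_of_nonneg (mul_nonneg hc (twS_nonneg _ _ _))]
    exact mul_le_mul_of_nonneg_left (twS_le _ _ _ hM) hc
  choose W hW using hex
  have hst : ∀ n m, ∀ t ∈ Icc 0 T, |W n t - W m t| ≤ (c * |e n - e m|) * T := by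
    intro n m t ht
    refine (tw_stab (by positivity) (hmono _) (hmono _) (hW n) (hW m) (fun x => ?_) t ht).trans
      (mul_le_mul_of_nonneg_left ht.2 (by positivity))
    rw [← mul_sub, abs_mul, abs_of_nonneg hc]
    exact mul_le_mul_of_nonneg_left (twS_eps (he0 n).le (he0 m).le x) hc
  have hcau : ∀ t ∈ Icc 0 T, ∃ l, Tendsto (fun n => W n t) atTop (nhds l) := by
    intro t ht
    refine cauchySeq_tendsto_of_complete ?_
    have hce : CauchySeq e := hel.cauchySeq
    rw [Metric.cauchySeq_iff] at hce ⊢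
    intro ε hε
    obtain ⟨N, hN⟩ := hce (ε / (c * T + 1)) (by positivity)
    refine ⟨N, fun m hm n hn => ?_⟩
    have h1 := hN m hm n hn
    rw [Real.dist_eq] at h1 ⊢
    have h2 := hst m n t ht
    rw [lt_div_iff₀ (by positivity)] at h1
    nlinarith [abs_nonneg (e m - e n)]
  choose! α hα using hcau
  have hlim : ∀ n, ∀ t ∈ Icc 0 T, |W n t - α t| ≤ c * e n * T := by
    intro n t ht
    have h1 : Tendsto (fun m => |W n t - W m t|) atTop (nhds |W n t - α t|) :=
      (tendsto_const_nhds.sub (hα t ht)).abs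
    have h2 : Tendsto (fun m => (c * |e n - e m|) * T) atTop (nhds (c * |e n - 0| * T)) :=
      ((tendsto_const_nhds.sub hel).abs.const_mul c).mul_const T
    have := le_of_tendsto_of_tendsto' h1 h2 (fun m => hst n m t ht)
    rwa [sub_zero, abs_of_pos (he0 n)] at this
  have hWc : ∀ n, ContinuousOn (W n) (Icc 0 T) := fun n t ht =>
    ((hW n).2 t ht).continuousAt.continuousWithinAt
  have hαc : ContinuousOn α (Icc 0 T) := by
    have : TendstoUniformlyOn W α atTop (Icc 0 T) := by
      rw [Metric.tendstoUniformlyOn_iff]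
      intro ε hε
      have h2 : Tendsto (fun n => c * e n * T) atTop (nhds (c * 0 * T)) :=
        (hel.const_mul c).mul_const T
      simp only [mul_zero, zero_mul] at h2
      filter_upwards [h2.eventually (gt_mem_nhds hε)] with n hn t ht
      rw [dist_comm, Real.dist_eq]
      exact (hlim n t ht).trans_lt hn
    exact this.continuousOn (Frequently.of_forall hWc)
  have hgc : ∀ ε, Continuous (fun w => c * twS M ε w) := fun ε =>
    continuous_const.mul (twS_cont M ε)
  obtain ⟨V, hV, -⟩ := tw_ext hT hh (hgc 0) hαc (fun t ht => by
    have hsub : Icc 0 t ⊆ Icc 0 T := Icc_subset_Icc_right ht.2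
    have hci : ∀ n, ContinuousOn (fun s => h s - c * twS M (e n) (W n s)) (Icc 0 t) := fun n =>
      hh.continuousOn.sub ((hgc (e n)).comp_continuousOn ((hWc n).mono hsub))
    have hint : ∀ n, W n t = ∫ s in (0:ℝ)..t, (h s - c * twS M (e n) (W n s)) := by
      intro n
      have := intervalIntegral.integral_eq_sub_of_hasDerivAt (a := 0) (b := t) (f := W n)
        (f' := fun s => h s - c * twS M (e n) (W n s))
        (fun x hx => (hW n).2 x (hsub (by rwa [uIcc_of_le ht.1] at hx)))
        ((hci n).intervalIntegrable_of_Icc ht.1)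
      rw [this, (hW n).1, sub_zero]
    refine tendsto_nhds_unique (hα t ht) ?_
    have hD : Tendsto (fun n => ∫ s in (0:ℝ)..t, (h s - c * twS M (e n) (W n s))) atTop
        (nhds (∫ s in (0:ℝ)..t, (h s - c * twS M 0 (α s)))) := by
      refine intervalIntegral.tendsto_integral_filter_of_dominated_convergence
        (fun _ => B + c * √(2 * M + 1)) ?_ ?_ (by simp) ?_
      · refine Eventually.of_forall fun n => ?_
        rw [uIoc_of_le ht.1]
        exact ((hci n).mono Ioc_subset_Icc_self).aestronglyMeasurable measurableSet_Ioc
      · refine Eventually.of_forall fun n => Eventually.of_forall fun s _ => ?_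
        have h1 : twS M (e n) (W n s) ≤ √(2 * M + 1) := by
          refine (twS_le _ _ _ hM).trans (Real.sqrt_le_sqrt ?_)
          nlinarith [he0 n, he1 n]
        calc ‖h s - c * twS M (e n) (W n s)‖ ≤ |h s| + |c * twS M (e n) (W n s)| := abs_sub _ _
          _ ≤ B + c * √(2 * M + 1) := by
            rw [abs_of_nonneg (mul_nonneg hc (twS_nonneg _ _ _))]
            exact add_le_add (hhB s) (mul_le_mul_of_nonneg_left h1 hc)
      · refine Eventually.of_forall fun s hs => ?_
        rw [uIoc_of_le ht.1] at hs
        have hs' : s ∈ Icc 0 T := hsub (Ioc_subset_Icc_self hs)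
        refine tendsto_const_nhds.sub (Tendsto.const_mul c ?_)
        have h1 : Tendsto (fun n => twS M 0 (W n s)) atTop (nhds (twS M 0 (α s))) :=
          ((twS_cont M 0).tendsto _).comp (hα s hs')
        have h2 : Tendsto (fun n => twS M (e n) (W n s) - twS M 0 (W n s)) atTop (nhds 0) := by
          refine squeeze_zero_norm (fun n => ?_) hel
          have := twS_eps (M := M) (he0 n).le le_rfl (W n s)
          rwa [sub_zero, abs_of_pos (he0 n)] at this
        simpa using h2.add h1
    exact hD.congr fun n => (hint n).symm)
  exact ⟨V, hV⟩

lemma twS_eq {M w : ℝ} (h : w ≤ M) : twS M 0 w = √(2 * w) := by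
  unfold twS
  rw [min_eq_left (by linarith)]
  rcases le_total 0 (2 * w) with h1 | h1
  · rw [max_eq_right h1]; simp
  · rw [max_eq_left h1, Real.sqrt_eq_zero_of_nonpos h1]; simp

lemma tw_family {T B : ℝ} (hT : 0 ≤ T) (hB : 0 ≤ B) {h : ℝ → ℝ}
    (hh : Continuous h) (hhB : ∀ t, |h t| ≤ B) :
    ∃ W : ℝ → ℝ → ℝ, (∀ c, 0 ≤ c → TwSol T h (fun w => c * √(2 * w)) (W c)) ∧
      ContinuousOn (fun c => W c T) (Ici 0) := by
  have hM : 0 ≤ B * T := by positivity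
  have hex : ∀ c : ℝ, 0 ≤ c → ∃ W, TwSol T h (fun w => c * twS (B * T) 0 w) W :=
    fun c hc => tw_exist hT hB hM hc hh hhB
  choose! W hW using hex
  refine ⟨W, fun c hc => ⟨(hW c hc).1, fun t ht => ?_⟩, ?_⟩
  · have hle : W c t ≤ B * T := by
      have := tw_cmp (B := fun t => B * t) (B' := fun _ => B) (hW c hc).2
        (fun x _ => by simpa using (hasDerivAt_id x).const_mul B) (by simp [(hW c hc).1])
        (fun x _ => by
          have h1 := (abs_le.1 (hhB x)).2
          have h2 := mul_nonneg hc (twS_nonneg (B * T) 0 (W c x))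
          linarith) t ht
      exact this.trans (mul_le_mul_of_nonneg_left ht.2 hB)
    have := (hW c hc).2 t ht
    simp only [twS_eq hle] at this
    exact this
  · have : LipschitzOnWith (√(2 * (B * T)) * T).toNNReal (fun c => W c T) (Ici 0) := by
      refine LipschitzOnWith.of_dist_le_mul fun x hx y hy => ?_
      rw [Real.coe_toNNReal _ (by positivity), Real.dist_eq, Real.dist_eq]
      have := tw_stab (η := √(2 * (B * T)) * |x - y|) (by positivity)
        ((twS_mono (B * T) 0).const_mul hx) ((twS_mono (B * T) 0).const_mul hy)
        (hW x hx) (hW y hy) (fun w => by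
          rw [← sub_mul, abs_mul, mul_comm, abs_of_nonneg (twS_nonneg _ _ _)]
          have := twS_le (B * T) 0 w hM
          simp only [ne_eq, OfNat.ofNat_ne_zero, not_false_eq_true, zero_pow, add_zero] at this
          gcongr) T ⟨hT, le_rfl⟩
      calc _ ≤ _ := this
        _ = _ := by ring
    exact this.continuousOn


lemma tw_reflect {Q c : ℝ} {f W : ℝ → ℝ}
    (hW : TwSol Q (fun t => f (Q - t)) (fun w => c * √(2 * w)) W) :
    ∀ u ∈ Icc 0 Q, HasDerivAt (fun u => W (Q - u)) (c * √(2 * W (Q - u)) - f u) u := by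
  intro u hu
  have h1 := hW.2 (Q - u) ⟨by linarith [hu.2], by linarith [hu.1]⟩
  have h2 : HasDerivAt (fun u => Q - u) (-1) u := by
    simpa using (hasDerivAt_id u).const_sub Q
  have h3 := HasDerivAt.comp u h1 h2
  refine h3.congr_deriv ?_
  simp

lemma tw_profile {P Q B : ℝ} (hP : 0 < P) (hPQ : P < Q) (hB : 0 ≤ B) {f : ℝ → ℝ}
    (hf : Continuous f) (hfB : ∀ t, |f t| ≤ B) (hneg : ∀ u ∈ Ioo 0 P, f u < 0)
    (hI : 0 < ∫ s in (0:ℝ)..Q, f s) :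
    ∃ c, 0 < c ∧ ∃ w : ℝ → ℝ, w 0 = 0 ∧ w Q = 0 ∧
      ∀ u ∈ Icc 0 Q, HasDerivAt w (c * √(2 * w u) - f u) u := by
  have hQ : 0 < Q := hP.trans hPQ
  obtain ⟨W, hW, hWc⟩ := tw_family (T := Q) hQ.le hB (h := fun t => f (Q - t))
    (hf.comp (continuous_const.sub continuous_id)) (fun t => hfB _)
  have hW0 : 0 < W 0 Q := by
    have h1 := intervalIntegral.integral_eq_sub_of_hasDerivAt (a := 0) (b := Q) (f := W 0)
        (f' := fun s => f (Q - s))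
        (fun x hx => by
          have := (hW 0 le_rfl).2 x (by rwa [uIcc_of_le hQ.le] at hx)
          simpa using this)
        ((hf.comp (continuous_const.sub continuous_id)).intervalIntegrable _ _)
    rw [(hW 0 le_rfl).1, sub_zero] at h1
    rw [← h1]
    simpa using hI
  set m := ∫ s in (0:ℝ)..(P / 2), - f s with hm
  have hmpos : 0 < m := by
    refine intervalIntegral.intervalIntegral_pos_of_pos_on (hf.neg.intervalIntegrable _ _)
      (fun x hx => ?_) (by linarith)
    have := hneg x ⟨hx.1, by linarith [hx.2]⟩
    linarith
  set C := (B * Q + 1) / (√(2 * m) * (P / 2)) with hC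
  have hsq : 0 < √(2 * m) := Real.sqrt_pos.2 (by linarith)
  have hCpos : 0 < C := by positivity
  have hWC : W C Q ≤ 0 := by
    by_contra hcon
    push Not at hcon
    set w : ℝ → ℝ := fun u => W C (Q - u) with hw
    have hd : ∀ u ∈ Icc 0 Q, HasDerivAt w (C * √(2 * w u) - f u) u :=
      tw_reflect (hW C hCpos.le)
    have hw0 : 0 < w 0 := by simpa [hw] using hcon
    have hwQ : w Q = 0 := by simp [hw, (hW C hCpos.le).1]
    have hs : ∀ u, 0 ≤ C * √(2 * w u) := fun u => by positivity
    have s1 : m ≤ w (P / 2) := by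
      refine tw_cmp (a := 0) (b := P / 2) (f := fun u => ∫ s in (0:ℝ)..u, - f s)
        (f' := fun u => - f u) (B := w)
        (fun x _ => ?_) (fun x hx => hd x ⟨hx.1, by linarith [hx.2]⟩) (by simpa using hw0.le)
        (fun x _ => by linarith [hs x]) (P / 2) ⟨by linarith, le_rfl⟩
      exact intervalIntegral.integral_hasDerivAt_right (hf.neg.intervalIntegrable _ _)
        (hf.neg.stronglyMeasurableAtFilter _ _) hf.neg.continuousAt
    have s2 : ∀ u ∈ Icc (P / 2) P, m ≤ w u := by
      refine tw_cmp (f := fun _ => m) (f' := fun _ => 0) (B := w)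
        (fun x _ => hasDerivAt_const _ _) (fun x hx => hd x ⟨by linarith [hx.1], by linarith [hx.2]⟩)
        s1 (fun x hx => ?_)
      have := hneg x ⟨by linarith [hx.1], hx.2⟩
      linarith [hs x]
    have s3 : C * √(2 * m) * (P - P / 2) ≤ w P := by
      refine tw_cmp (a := P / 2) (b := P) (f := fun u => C * √(2 * m) * (u - P / 2))
        (f' := fun _ => C * √(2 * m)) (B := w)
        (fun x _ => by simpa using ((hasDerivAt_id x).sub_const (P / 2)).const_mul (C * √(2 * m)))
        (fun x hx => hd x ⟨by linarith [hx.1], by linarith [hx.2]⟩)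
        (by simpa using hmpos.le.trans s1) (fun x hx => ?_) P ⟨by linarith, le_rfl⟩
      have h1 := hneg x ⟨by linarith [hx.1], hx.2⟩
      have h2 : √(2 * m) ≤ √(2 * w x) :=
        Real.sqrt_le_sqrt (by linarith [s2 x (Ico_subset_Icc_self hx)])
      have h3 := mul_le_mul_of_nonneg_left h2 hCpos.le
      linarith
    have s4 : w P - B * (Q - P) ≤ w Q := by
      refine tw_cmp (a := P) (b := Q) (f := fun u => w P - B * (u - P))
        (f' := fun _ => - B) (B := w)
        (fun x _ => by
          simpa using (((hasDerivAt_id x).sub_const P).const_mul B).const_sub (w P))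
        (fun x hx => hd x ⟨by linarith [hx.1], by linarith [hx.2]⟩)
        (by simp) (fun x hx => ?_) Q ⟨hPQ.le, le_rfl⟩
      have h1 := (abs_le.1 (hfB x)).2
      linarith [hs x]
    have s5 : C * √(2 * m) * (P - P / 2) = B * Q + 1 := by
      rw [hC]; field_simp; ring
    nlinarith
  obtain ⟨c, hc, hcz⟩ : (0:ℝ) ∈ (fun c => W c Q) '' Icc 0 C :=
    intermediate_value_Icc' hCpos.le (hWc.mono Icc_subset_Ici_self) ⟨hWC, hW0.le⟩
  have hcpos : 0 < c := lt_of_le_of_ne hc.1 (by rintro rfl; simp only at hcz; linarith)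
  refine ⟨c, hcpos, fun u => W c (Q - u), by simpa using hcz, by simp [(hW c hc.1).1],
    tw_reflect (hW c hc.1)⟩

lemma tw_pos {P Q c : ℝ} (hP : 0 < P) (hPQ : P < Q) (hc : 0 < c) {f w : ℝ → ℝ}
    (hneg : ∀ u ∈ Ioo 0 P, f u < 0) (hpos : ∀ u ∈ Ioo P Q, 0 < f u)
    (hw0 : w 0 = 0) (hwQ : w Q = 0)
    (hd : ∀ u ∈ Icc 0 Q, HasDerivAt w (c * √(2 * w u) - f u) u) :
    ∀ u ∈ Ioo 0 Q, 0 < w u := by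
  have hs : ∀ u, 0 ≤ c * √(2 * w u) := fun u => by positivity
  intro u hu
  rcases le_or_gt u P with h | h
  · have hm : StrictMonoOn w (Icc 0 P) := by
      refine strictMonoOn_of_deriv_pos (convex_Icc _ _)
        (fun x hx => (hd x ⟨hx.1, hx.2.trans hPQ.le⟩).continuousAt.continuousWithinAt) ?_
      intro x hx
      rw [interior_Icc] at hx
      rw [(hd x ⟨hx.1.le, hx.2.le.trans hPQ.le⟩).deriv]
      linarith [hs x, hneg x hx]
    have := hm ⟨le_rfl, hP.le⟩ ⟨hu.1.le, h⟩ hu.1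
    linarith
  · by_contra hcon
    push Not at hcon
    have hd' : ∀ x ∈ Icc u Q, HasDerivAt w (c * √(2 * w x) - f x) x :=
      fun x hx => hd x ⟨hu.1.le.trans hx.1, hx.2⟩
    have h1 : ∀ x ∈ Icc u Q, w x ≤ 0 := by
      refine tw_cmp_lt (B := fun _ => 0) (B' := fun _ => 0) hd' (fun x _ => hasDerivAt_const _ _)
        hcon (fun x hx hxe => ?_)
      have := hpos x ⟨h.trans_le hx.1, hx.2⟩
      rw [hxe]; simpa using this
    have hm : StrictAntiOn w (Icc u Q) := by
      refine strictAntiOn_of_deriv_neg (convex_Icc _ _)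
        (fun x hx => (hd' x hx).continuousAt.continuousWithinAt) ?_
      intro x hx
      rw [interior_Icc] at hx
      rw [(hd' x ⟨hx.1.le, hx.2.le⟩).deriv, Real.sqrt_eq_zero_of_nonpos
        (by linarith [h1 x ⟨hx.1.le, hx.2.le⟩])]
      have := hpos x ⟨h.trans hx.1, hx.2⟩
      linarith
    have := hm ⟨le_rfl, hu.2.le⟩ ⟨hu.2.le, le_rfl⟩ hu.2
    linarith

lemma tw_bound_zero {Q c L : ℝ} (hc : 0 < c) (hL : 0 ≤ L) {f w : ℝ → ℝ}
    (hfL : ∀ u ∈ Icc 0 Q, |f u| ≤ L * u) (hw0 : w 0 = 0)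
    (hd : ∀ u ∈ Icc 0 Q, HasDerivAt w (c * √(2 * w u) - f u) u) :
    ∀ u ∈ Icc 0 Q, √(2 * w u) ≤ 2 * (c + L + 1) * u := by
  intro u hu
  set s := c + L + 1 with hs
  have hs1 : 1 ≤ s := by linarith
  have key : ∀ ε > 0, w u ≤ 2 * s ^ 2 * (u + ε) ^ 2 := by
    intro ε hε
    refine tw_cmp_lt (a := 0) (b := Q) (B := fun u => 2 * s ^ 2 * (u + ε) ^ 2)
      (B' := fun u => 4 * s ^ 2 * (u + ε)) hd (fun x _ => ?_) (by rw [hw0]; positivity) ?_ u hu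
    · have := (((hasDerivAt_id x).add_const ε).pow 2).const_mul (2 * s ^ 2)
      refine this.congr_deriv ?_
      simp; ring
    · intro x hx hxe
      have hx0 := hx.1
      have h1 : √(2 * w x) = 2 * s * (x + ε) := by
        rw [hxe, show 2 * (2 * s ^ 2 * (x + ε) ^ 2) = (2 * s * (x + ε)) ^ 2 by ring]
        exact Real.sqrt_sq (by positivity)
      rw [h1]
      have h2 := (abs_le.1 (hfL x (Ico_subset_Icc_self hx))).1
      have h3 : 0 < x + ε := by linarith
      have h4 : 2 * c * s + L < 4 * s ^ 2 := by nlinarith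
      nlinarith [mul_lt_mul_of_pos_right h4 h3]
  have hle : w u ≤ 2 * s ^ 2 * u ^ 2 := by
    have hl : Tendsto (fun ε : ℝ => 2 * s ^ 2 * (u + ε) ^ 2) (nhdsWithin 0 (Ioi 0))
        (nhds (2 * s ^ 2 * (u + 0) ^ 2)) := by
      refine Tendsto.mono_left (Continuous.tendsto ?_ 0) nhdsWithin_le_nhds
      fun_prop
    rw [add_zero] at hl
    exact ge_of_tendsto hl (by filter_upwards [self_mem_nhdsWithin] with ε hε using key ε hε)
  have hu0 := hu.1
  rw [Real.sqrt_le_left (by positivity)]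
  nlinarith

lemma tw_bound_Q {Q c L : ℝ} (hc : 0 < c) (hL : 0 ≤ L) {f w : ℝ → ℝ}
    (hfL : ∀ u ∈ Icc 0 Q, |f u| ≤ L * (Q - u)) (hwQ : w Q = 0)
    (hd : ∀ u ∈ Icc 0 Q, HasDerivAt w (c * √(2 * w u) - f u) u) :
    ∀ u ∈ Icc 0 Q, √(2 * w u) ≤ (L + 1) * (Q - u) := by
  intro u hu
  have hle : w u - L * (Q - u) ^ 2 / 2 ≤ w Q - L * (Q - Q) ^ 2 / 2 := by
    refine tw_cmp (a := u) (b := Q) (f := fun _ => w u - L * (Q - u) ^ 2 / 2) (f' := fun _ => 0)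
      (B := fun x => w x - L * (Q - x) ^ 2 / 2)
      (B' := fun x => (c * √(2 * w x) - f x) + L * (Q - x))
      (fun x _ => hasDerivAt_const _ _) (fun x hx => ?_) le_rfl (fun x hx => ?_) Q ⟨hu.2, le_rfl⟩
    · have h1 := hd x ⟨hu.1.trans hx.1, hx.2⟩
      have h2 := ((((hasDerivAt_id x).const_sub Q).pow 2).const_mul L).div_const 2
      refine (h1.sub h2).congr_deriv ?_
      simp; ring
    · have h1 := (abs_le.1 (hfL x ⟨hu.1.trans hx.1, hx.2.le⟩)).2
      have h2 : 0 ≤ c * √(2 * w x) := by positivity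
      linarith
  rw [hwQ] at hle
  have hu2 : 0 ≤ Q - u := by linarith [hu.2]
  rw [Real.sqrt_le_left (by positivity)]
  nlinarith [mul_nonneg hL (sq_nonneg (Q - u)), sq_nonneg (L * (Q - u)), sq_nonneg (Q-u)]

lemma tw_wave {P Q c K : ℝ} (hP : 0 < P) (hPQ : P < Q) (hK : 0 < K) {f w : ℝ → ℝ}
    (hf : Continuous f) (hw : ∀ u ∈ Ioo 0 Q, 0 < w u)
    (hd : ∀ u ∈ Ioo 0 Q, HasDerivAt w (c * √(2 * w u) - f u) u)
    (hb0 : ∀ u ∈ Ioo 0 Q, √(2 * w u) ≤ K * u)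
    (hbQ : ∀ u ∈ Ioo 0 Q, √(2 * w u) ≤ K * (Q - u)) :
    ∃ φ : ℝ → ℝ, ContDiff ℝ 2 φ ∧ StrictMono φ ∧
      (∀ x : ℝ, φ x ∈ Ioo 0 Q ∧ deriv (deriv φ) x = c * deriv φ x - f (φ x)) ∧
      Tendsto φ atBot (nhds 0) ∧ Tendsto φ atTop (nhds Q) := by
  have hQ : 0 < Q := hP.trans hPQ
  set p : ℝ → ℝ := fun u => √(2 * w u) with hp
  have hpp : ∀ u ∈ Ioo 0 Q, 0 < p u := fun u hu => Real.sqrt_pos.2 (by linarith [hw u hu])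
  have hpd : ∀ u ∈ Ioo 0 Q, HasDerivAt p ((c * p u - f u) / p u) u := by
    intro u hu
    have h1 := ((hd u hu).const_mul 2).sqrt (by linarith [hw u hu])
    refine h1.congr_deriv ?_
    have := hpp u hu
    simp only [hp] at this ⊢
    field_simp
  have hpc : ContinuousOn (fun u => (p u)⁻¹) (Ioo 0 Q) := fun u hu =>
    ((hpd u hu).continuousAt.inv₀ (hpp u hu).ne').continuousWithinAt
  set G : ℝ → ℝ := fun u => ∫ s in P..u, (p s)⁻¹ with hG
  have hPm : P ∈ Ioo 0 Q := ⟨hP, hPQ⟩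
  have hGd : ∀ u ∈ Ioo 0 Q, HasDerivAt G (p u)⁻¹ u := by
    intro u hu
    refine intervalIntegral.integral_hasDerivAt_right ?_
      (hpc.stronglyMeasurableAtFilter isOpen_Ioo u hu) (hpc.continuousAt (isOpen_Ioo.mem_nhds hu))
    exact (hpc.mono (ordConnected_Ioo.uIcc_subset hPm hu)).intervalIntegrable
  have hGP : G P = 0 := by simp [hG]
  have hGc : ContinuousOn G (Ioo 0 Q) := fun u hu => (hGd u hu).continuousAt.continuousWithinAt
  have hGm : StrictMonoOn G (Ioo 0 Q) := by
    refine strictMonoOn_of_deriv_pos (convex_Ioo _ _) hGc ?_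
    intro x hx
    rw [interior_Ioo] at hx
    rw [(hGd x hx).deriv]
    exact inv_pos.2 (hpp x hx)
  have hsurj : ∀ y, ∃ u ∈ Ioo 0 Q, G u = y := by
    intro y
    have hexp : Real.exp (-(K * |y|)) ≤ 1 := Real.exp_le_one_iff.2 (by
      have : 0 ≤ K * |y| := by positivity
      linarith)
    have hexp0 := Real.exp_pos (-(K * |y|))
    set E := Real.exp (-(K * |y|)) with hE
    set a := P * E with ha
    have ha0 : 0 < a := by positivity
    have haP : a ≤ P := by nlinarith
    set b := Q - (Q - P) * E with hbd
    have hQP : 0 < Q - P := by linarith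
    have hbQ' : b < Q := by nlinarith [mul_pos hQP hexp0]
    have hPb : P ≤ b := by nlinarith
    have hGa : G a ≤ y := by
      have h := tw_cmp (a := a) (b := P) (f := fun _ => G a - K⁻¹ * Real.log a) (f' := fun _ => 0)
        (B := fun x => G x - K⁻¹ * Real.log x) (B' := fun x => (p x)⁻¹ - K⁻¹ * x⁻¹)
        (fun x _ => hasDerivAt_const _ _)
        (fun x hx => (hGd x ⟨ha0.trans_le hx.1, hx.2.trans_lt hPQ⟩).sub
          ((Real.hasDerivAt_log (ha0.trans_le hx.1).ne').const_mul _)) le_rfl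
        (fun x hx => by
          have hx' : x ∈ Ioo 0 Q := ⟨ha0.trans_le hx.1, hx.2.trans hPQ⟩
          rw [← mul_inv]
          exact sub_nonneg.2 (inv_anti₀ (hpp x hx') (hb0 x hx'))) P ⟨haP, le_rfl⟩
      simp only [hGP] at h
      rw [ha, Real.log_mul hP.ne' hexp0.ne', hE, Real.log_exp] at h
      have h2 : K⁻¹ * (Real.log P + -(K * |y|)) = K⁻¹ * Real.log P - |y| := by
        field_simp; ring
      rw [h2, ← hE, ← ha] at h
      linarith [neg_abs_le y]
    have hGb : y ≤ G b := by
      have h := tw_cmp (a := P) (b := b) (f := fun _ => G P + K⁻¹ * Real.log (Q - P))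
        (f' := fun _ => 0)
        (B := fun x => G x + K⁻¹ * Real.log (Q - x)) (B' := fun x => (p x)⁻¹ + K⁻¹ * (-1 / (Q - x)))
        (fun x _ => hasDerivAt_const _ _)
        (fun x hx => (hGd x ⟨hP.trans_le hx.1, hx.2.trans_lt hbQ'⟩).add
          ((((hasDerivAt_id x).const_sub Q).log
            (by have := hx.2; simp only [id]; linarith)).const_mul _)) le_rfl
        (fun x hx => by
          have hx' : x ∈ Ioo 0 Q := ⟨hP.trans_le hx.1, hx.2.trans hbQ'⟩
          have := inv_anti₀ (hpp x hx') (hbQ x hx')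
          rw [mul_inv] at this
          have h3 : K⁻¹ * (-1 / (Q - x)) = - (K⁻¹ * (Q - x)⁻¹) := by
            rw [neg_div, one_div, mul_neg]
          rw [h3]
          linarith) b ⟨hPb, le_rfl⟩
      simp only [hGP] at h
      have hb2 : Q - b = (Q - P) * E := by rw [hbd]; ring
      rw [hb2, Real.log_mul hQP.ne' hexp0.ne', hE, Real.log_exp] at h
      have h2 : K⁻¹ * (Real.log (Q - P) + -(K * |y|)) = K⁻¹ * Real.log (Q - P) - |y| := by
        field_simp; ring
      rw [h2] at h
      linarith [le_abs_self y]
    have hsub : Icc a b ⊆ Ioo 0 Q := fun x hx => ⟨ha0.trans_le hx.1, hx.2.trans_lt hbQ'⟩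
    obtain ⟨u, hu, hy⟩ := intermediate_value_Icc (haP.trans hPb) (hGc.mono hsub) ⟨hGa, hGb⟩
    exact ⟨u, hsub hu, hy⟩
  choose φ hφ hGφ using hsurj
  have hφG : ∀ u ∈ Ioo 0 Q, φ (G u) = u := fun u hu =>
    hGm.injOn (hφ _) hu (hGφ _)
  have hφm : StrictMono φ := fun x y hxy => by
    rw [← hGm.lt_iff_lt (hφ x) (hφ y), hGφ, hGφ]; exact hxy
  have hrange : range φ = Ioo 0 Q := by
    ext u
    constructor
    · rintro ⟨x, rfl⟩; exact hφ x
    · intro hu; exact ⟨G u, hφG u hu⟩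
  have hφc : Continuous φ := by
    rw [continuous_iff_continuousAt]
    intro x
    refine (hφm.strictMonoOn univ).continuousAt_of_image_mem_nhds univ_mem ?_
    rw [image_univ, hrange]
    exact isOpen_Ioo.mem_nhds (hφ x)
  have hφd : ∀ x, HasDerivAt φ (p (φ x)) x := fun x => by
    have := HasDerivAt.of_local_left_inverse hφc.continuousAt (hGd _ (hφ x))
      (inv_pos.2 (hpp _ (hφ x))).ne' (Eventually.of_forall hGφ)
    rwa [inv_inv] at this
  have hφ1 : deriv φ = fun x => p (φ x) := funext fun x => (hφd x).deriv
  have hφdd : ∀ x, HasDerivAt (fun x => p (φ x)) (c * p (φ x) - f (φ x)) x := fun x => by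
    have := HasDerivAt.comp x (hpd _ (hφ x)) (hφd x)
    refine this.congr_deriv ?_
    exact div_mul_cancel₀ _ (hpp _ (hφ x)).ne'
  have hφ2 : deriv (fun x => p (φ x)) = fun x => c * p (φ x) - f (φ x) :=
    funext fun x => (hφdd x).deriv
  refine ⟨φ, ?_, hφm, fun x => ⟨hφ x, by rw [hφ1, hφ2]⟩, ?_, ?_⟩
  · rw [show (2 : WithTop ℕ∞) = 1 + 1 from by norm_num, contDiff_succ_iff_deriv]
    refine ⟨fun x => (hφd x).differentiableAt, by simp, ?_⟩
    rw [hφ1, contDiff_one_iff_deriv]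
    refine ⟨fun x => (hφdd x).differentiableAt, ?_⟩
    rw [hφ2]
    have : Continuous fun x => p (φ x) :=
      continuous_iff_continuousAt.2 fun x => (hφdd x).continuousAt
    exact (continuous_const.mul this).sub (hf.comp hφc)
  · refine tendsto_atBot_isGLB hφm.monotone ?_
    rw [hrange]; exact isGLB_Ioo hQ
  · refine tendsto_atTop_isLUB hφm.monotone ?_
    rw [hrange]; exact isLUB_Ioo hQ


/-- existence of a bistable traveling wave (Lemma 3.1 / \cite{AW1978}). -/
theorem bistable_traveling_wave (d P Q : ℝ) (F : ℝ → ℝ)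
    (hd : 0 < d) (hF : CondFb F P Q) :
    ∃ c : ℝ, 0 < c ∧ ∃ φ : ℝ → ℝ, ContDiff ℝ 2 φ ∧ StrictMono φ ∧
      (∀ x : ℝ, d * deriv (deriv φ) x - c * deriv φ x + F (φ x) = 0) ∧
      Tendsto φ atBot (nhds 0) ∧ Tendsto φ atTop (nhds Q) := by
  obtain ⟨hP, hPQ, hC, hF0, -, hFQ, -, -, hneg, -, hpos, hI⟩ := hF
  have hQ : 0 < Q := hP.trans hPQ
  obtain ⟨K, hK⟩ := (hC.mono (Icc_subset_Ici_self : Icc 0 Q ⊆ Ici 0)).exists_lipschitzOnWith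
    one_ne_zero (convex_Icc 0 Q) isCompact_Icc
  set f : ℝ → ℝ := fun u => F (projIcc 0 Q hQ.le u) / d with hf
  have hfe : ∀ u ∈ Icc 0 Q, f u = F u / d := fun u hu => by
    simp only [hf]; rw [projIcc_of_mem _ hu]
  have hfc : Continuous f := by
    refine Continuous.div_const ?_ d
    exact hK.continuousOn.comp_continuous (continuous_subtype_val.comp continuous_projIcc)
      (fun x => (projIcc 0 Q hQ.le x).2)
  have hl0 : ∀ u ∈ Icc 0 Q, |F u| ≤ K * u := fun u hu => by
    have := hK.dist_le_mul u hu 0 ⟨le_rfl, hQ.le⟩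
    rwa [hF0, Real.dist_eq, Real.dist_eq, sub_zero, sub_zero, abs_of_nonneg hu.1] at this
  have hlQ : ∀ u ∈ Icc 0 Q, |F u| ≤ K * (Q - u) := fun u hu => by
    have := hK.dist_le_mul u hu Q ⟨hQ.le, le_rfl⟩
    rwa [hFQ, Real.dist_eq, Real.dist_eq, sub_zero, abs_sub_comm u,
      abs_of_nonneg (sub_nonneg.2 hu.2)] at this
  have hL : (0:ℝ) ≤ K / d := by positivity
  have hfl0 : ∀ u ∈ Icc 0 Q, |f u| ≤ K / d * u := fun u hu => by
    rw [hfe u hu, abs_div, abs_of_pos hd, div_mul_eq_mul_div]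
    exact div_le_div_of_nonneg_right (hl0 u hu) hd.le
  have hflQ : ∀ u ∈ Icc 0 Q, |f u| ≤ K / d * (Q - u) := fun u hu => by
    rw [hfe u hu, abs_div, abs_of_pos hd, div_mul_eq_mul_div]
    exact div_le_div_of_nonneg_right (hlQ u hu) hd.le
  have hfB : ∀ u, |f u| ≤ K / d * Q := fun u => by
    have hm := (projIcc 0 Q hQ.le u).2
    have h1 : f u = f (projIcc 0 Q hQ.le u) := by
      simp only [hf]; rw [projIcc_val]
    rw [h1]
    exact (hfl0 _ hm).trans (mul_le_mul_of_nonneg_left hm.2 hL)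
  have hfneg : ∀ u ∈ Ioo 0 P, f u < 0 := fun u hu => by
    rw [hfe u ⟨hu.1.le, hu.2.le.trans hPQ.le⟩]
    exact div_neg_of_neg_of_pos (hneg u hu) hd
  have hfpos : ∀ u ∈ Ioo P Q, 0 < f u := fun u hu => by
    rw [hfe u ⟨hP.le.trans hu.1.le, hu.2.le⟩]
    exact div_pos (hpos u hu) hd
  have hfI : 0 < ∫ s in (0:ℝ)..Q, f s := by
    have : ∫ s in (0:ℝ)..Q, f s = ∫ s in (0:ℝ)..Q, F s / d :=
      intervalIntegral.integral_congr fun s hs => hfe s (by rwa [uIcc_of_le hQ.le] at hs)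
    rw [this, intervalIntegral.integral_div]
    exact div_pos hI hd
  obtain ⟨c, hc, w, hw0, hwQ, hwd⟩ := tw_profile hP hPQ (by positivity) hfc hfB hfneg hfI
  have hwp := tw_pos hP hPQ hc hfneg hfpos hw0 hwQ hwd
  have b0 := tw_bound_zero hc hL hfl0 hw0 hwd
  have bQ := tw_bound_Q hc hL hflQ hwQ hwd
  obtain ⟨φ, h1, h2, h3, h4, h5⟩ := tw_wave (c := c) (K := 2 * (c + K / d + 1)) hP hPQ
    (by positivity) hfc hwp (fun u hu => hwd u (Ioo_subset_Icc_self hu))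
    (fun u hu => b0 u (Ioo_subset_Icc_self hu))
    (fun u hu => (bQ u (Ioo_subset_Icc_self hu)).trans
      (mul_le_mul_of_nonneg_right (by linarith) (by linarith [hu.2])))
  refine ⟨d * c, by positivity, φ, h1, h2, fun x => ?_, h4, h5⟩
  rw [(h3 x).2, hfe _ (Ioo_subset_Icc_self (h3 x).1)]
  field_simp
  ring
end

section
/- A priori bounds (Lemma 3.4). Assume f satisfies conditions (f2) and (f3) with constant M₀, T ∈ (0,∞), and (u,g,h) is a classical solution of the free boundary problem (c) with initial datum u₀ ∈ X(h₀) on [0,T). Set C₂ := max_{x ∈ [−h₀,h₀]} u₀(x) + M₀, and let L > 0 be any constant such that f(t,x,v) ≥ −L·v for all t ∈ [0,T), x ∈ ℝ, v ∈ [0,C₂]. Then for all t ∈ (0,T) and x ∈ [g(t), h(t)]: e^{−Lt}·min_{[−h₀,h₀]} u₀ ≤ u(t,x) ≤ C₂, and h(t) − g(t) ≥ (2h₀/C₂)·e^{−Lt}·min_{[−h₀,h₀]} u₀. In particular, for each finite T there are positive constants C₁(T) and C₃(T) with u ≥ C₁(T) and h(t) − g(t) ≥ C₃(T) on (0,T).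 -/
open Set Filter

open scoped Topology

lemma apb_dd_nonneg {φ : ℝ → ℝ} {x : ℝ} (hm : IsLocalMin φ x) (hc : ContinuousAt φ x) :
    0 ≤ deriv (deriv φ) x := by
  by_contra hneg
  push Not at hneg
  have hmax := isLocalMax_of_deriv_deriv_neg hneg hm.deriv_eq_zero hc
  have heq : φ =ᶠ[𝓝 x] fun _ => φ x := by
    filter_upwards [hm, hmax] with y h1 h2
    exact le_antisymm h2 h1
  have h1 : deriv φ =ᶠ[𝓝 x] deriv (fun _ => φ x) := heq.deriv
  have h2 := h1.deriv_eq
  simp at h2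
  linarith

lemma apb_dd_nonpos {φ : ℝ → ℝ} {x : ℝ} (hm : IsLocalMax φ x) (hc : ContinuousAt φ x) :
    deriv (deriv φ) x ≤ 0 := by
  by_contra hneg
  push Not at hneg
  have hmin := isLocalMin_of_deriv_deriv_pos hneg hm.deriv_eq_zero hc
  have heq : φ =ᶠ[𝓝 x] fun _ => φ x := by
    filter_upwards [hm, hmin] with y h1 h2
    exact le_antisymm h1 h2
  have h1 : deriv φ =ᶠ[𝓝 x] deriv (fun _ => φ x) := heq.deriv
  have h2 := h1.deriv_eq
  simp at h2
  linarith

lemma apb_dt {φ : ℝ → ℝ} {a t : ℝ} (h : HasDerivAt φ a t)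
    (hl : ∀ᶠ s in 𝓝[<] t, φ t ≤ φ s) : a ≤ 0 := by
  have h1 := (hasDerivWithinAt_iff_tendsto_slope' (s := Iio t) (by simp)).1 h.hasDerivWithinAt
  refine le_of_tendsto h1 ?_
  filter_upwards [hl, self_mem_nhdsWithin] with s hs hst
  rw [slope_def_field]
  exact div_nonpos_of_nonneg_of_nonpos (by linarith) (by have : s < t := hst; linarith)

/-- First touching point. -/
lemma apb_touch {T : ℝ} {g h : ℝ → ℝ} {w : ℝ → ℝ → ℝ}
    (hg : ContinuousOn g (Ico 0 T)) (hh : ContinuousOn h (Ico 0 T))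
    (hgh : ∀ t ∈ Ico 0 T, g t < h t)
    (hw : ContinuousOn (fun p : ℝ × ℝ => w p.1 p.2)
      {p : ℝ × ℝ | p.1 ∈ Ico 0 T ∧ p.2 ∈ Icc (g p.1) (h p.1)})
    (h0 : ∀ x ∈ Icc (g 0) (h 0), 0 < w 0 x)
    (hbg : ∀ t ∈ Ioo 0 T, 0 < w t (g t)) (hbh : ∀ t ∈ Ioo 0 T, 0 < w t (h t))
    (hno : ∀ t ∈ Ioo 0 T, ∀ x ∈ Ioo (g t) (h t), w t x = 0 →
      (∀ y ∈ Ioo (g t) (h t), 0 ≤ w t y) → (∀ᶠ s in 𝓝[<] t, 0 ≤ w s x) → False) :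
    ∀ t ∈ Ico 0 T, ∀ x ∈ Icc (g t) (h t), 0 < w t x := by
  intro t₁ ht₁ x₁ hx₁
  by_contra hneg
  push Not at hneg
  have hsub : Icc 0 t₁ ⊆ Ico 0 T := fun s hs => ⟨hs.1, lt_of_le_of_lt hs.2 ht₁.2⟩
  set D : Set (ℝ × ℝ) := {p | p.1 ∈ Icc 0 t₁ ∧ p.2 ∈ Icc (g p.1) (h p.1)} with hD
  have hDc : IsCompact D := by
    have hDi : D = (fun p : ℝ × ℝ => (p.1, g p.1 + p.2 * (h p.1 - g p.1))) ''
        (Icc 0 t₁ ×ˢ Icc 0 1) := by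
      ext ⟨t, x⟩
      simp only [hD, mem_ofPred_eq, mem_image, mem_prod, Prod.mk.injEq, Prod.exists]
      constructor
      · rintro ⟨ht, hx⟩
        have hlt := hgh t (hsub ht)
        refine ⟨t, (x - g t) / (h t - g t), ⟨ht, ?_, ?_⟩, rfl, ?_⟩
        · exact div_nonneg (by linarith [hx.1]) (by linarith)
        · rw [div_le_one (by linarith)]; linarith [hx.2]
        · rw [div_mul_cancel₀ _ (by linarith)]; ring
      · rintro ⟨a, b, ⟨ha, hb⟩, rfl, rfl⟩
        have hlt := hgh a (hsub ha)
        refine ⟨ha, ?_, ?_⟩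
        · nlinarith [hb.1]
        · nlinarith [hb.2]
    rw [hDi]
    refine (isCompact_Icc.prod isCompact_Icc).image_of_continuousOn ?_
    have hg' : ContinuousOn (fun p : ℝ × ℝ => g p.1) (Icc 0 t₁ ×ˢ Icc (0:ℝ) 1) :=
      (hg.mono hsub).comp continuousOn_fst (fun p hp => hp.1)
    have hh' : ContinuousOn (fun p : ℝ × ℝ => h p.1) (Icc 0 t₁ ×ˢ Icc (0:ℝ) 1) :=
      (hh.mono hsub).comp continuousOn_fst (fun p hp => hp.1)
    exact continuousOn_fst.prodMk (hg'.add (continuousOn_snd.mul (hh'.sub hg')))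
  have hwD : ContinuousOn (fun p : ℝ × ℝ => w p.1 p.2) D :=
    hw.mono (fun p hp => ⟨hsub hp.1, hp.2⟩)
  set K := D ∩ (fun p : ℝ × ℝ => w p.1 p.2) ⁻¹' Iic 0 with hK
  have hKc : IsCompact K :=
    hDc.of_isClosed_subset (hwD.preimage_isClosed_of_isClosed hDc.isClosed isClosed_Iic)
      inter_subset_left
  have hKne : K.Nonempty := ⟨(t₁, x₁), ⟨⟨ht₁.1, le_rfl⟩, hx₁⟩, hneg⟩
  obtain ⟨⟨t, x⟩, ⟨⟨ht, hx⟩, hwle⟩, hmin⟩ := hKc.exists_isMinOn hKne continuousOn_fst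
  simp only at ht hx
  have hwle' : w t x ≤ 0 := hwle
  have hbefore : ∀ s, 0 ≤ s → s < t → ∀ y ∈ Icc (g s) (h s), 0 < w s y := by
    intro s hs0 hst y hy
    by_contra hc
    push Not at hc
    have := hmin (show (s, y) ∈ K from ⟨⟨⟨hs0, hst.le.trans ht.2⟩, hy⟩, hc⟩)
    simp at this
    linarith
  have htpos : 0 < t := by
    rcases ht.1.lt_or_eq with h1 | h1
    · exact h1
    · exfalso; subst h1; linarith [h0 x hx]
  have htI : t ∈ Ioo 0 T := ⟨htpos, (hsub ht).2⟩
  have hxI : x ∈ Ioo (g t) (h t) := by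
    refine ⟨lt_of_le_of_ne hx.1 ?_, lt_of_le_of_ne hx.2 ?_⟩
    · rintro h1; rw [← h1] at hwle'; linarith [hbg t htI]
    · rintro h1; rw [h1] at hwle'; linarith [hbh t htI]
  have hnear : ∀ y ∈ Ioo (g t) (h t), ∀ᶠ s in 𝓝[<] t, s ∈ Ico 0 T ∧ s < t ∧ y ∈ Icc (g s) (h s) := by
    intro y hy
    have hnh : Ico 0 T ∈ 𝓝 t := Ico_mem_nhds htI.1 htI.2
    have e1 := (hg.continuousAt hnh).eventually_lt continuousAt_const hy.1
    have e2 := continuousAt_const.eventually_lt (hh.continuousAt hnh) hy.2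
    filter_upwards [nhdsWithin_le_nhds hnh, self_mem_nhdsWithin, nhdsWithin_le_nhds e1,
      nhdsWithin_le_nhds e2] with s h1 h2 h3 h4
    exact ⟨h1, h2, h3.le, h4.le⟩
  have hge : ∀ y ∈ Ioo (g t) (h t), 0 ≤ w t y := by
    intro y hy
    have hc := hw (t, y) ⟨⟨htI.1.le, htI.2⟩, hy.1.le, hy.2.le⟩
    have ht2 : Tendsto (fun s : ℝ => (s, y)) (𝓝[<] t)
        (𝓝[{p : ℝ × ℝ | p.1 ∈ Ico 0 T ∧ p.2 ∈ Icc (g p.1) (h p.1)}] (t, y)) := by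
      refine tendsto_nhdsWithin_iff.2 ⟨?_, ?_⟩
      · exact (Continuous.tendsto (by fun_prop : Continuous fun s : ℝ => (s, y)) t).mono_left
          nhdsWithin_le_nhds
      · filter_upwards [hnear y hy] with s hs
        exact ⟨hs.1, hs.2.2⟩
    refine ge_of_tendsto (hc.tendsto.comp ht2) ?_
    filter_upwards [hnear y hy] with s hs
    exact (hbefore s hs.1.1 hs.2.1 y hs.2.2).le
  refine hno t htI x hxI (le_antisymm hwle' (hge x hxI)) hge ?_
  filter_upwards [hnear x hxI] with s hs
  exact (hbefore s hs.1.1 hs.2.1 x hs.2.2).le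

/-- Abstract mass inequality. -/
lemma apb_mass {T L s t A B : ℝ} {P Pt Q Qy : ℝ → ℝ → ℝ}
    (hs : 0 < s) (hst : s < t) (htT : t < T)
    (hP : ∀ t ∈ Ioo 0 T, ∀ y ∈ Ioo (0:ℝ) 1, HasDerivAt (fun s => P s y) (Pt t y) t)
    (hPc : ContinuousOn (fun p : ℝ × ℝ => P p.1 p.2) (Ioo 0 T ×ˢ Ioo 0 1))
    (hPtc : ContinuousOn (fun p : ℝ × ℝ => Pt p.1 p.2) (Ioo 0 T ×ˢ Ioo 0 1))
    (hQ : ∀ t ∈ Ioo 0 T, ∀ y ∈ Ioo (0:ℝ) 1, HasDerivAt (Q t) (Qy t y) y)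
    (hQyc : ∀ t ∈ Ioo 0 T, ContinuousOn (Qy t) (Ioo 0 1))
    (hineq : ∀ t ∈ Ioo 0 T, ∀ y ∈ Ioo (0:ℝ) 1, Qy t y - L * P t y ≤ Pt t y)
    (hQc : ContinuousOn (fun p : ℝ × ℝ => Q p.1 p.2) (Ioo 0 T ×ˢ Icc 0 1))
    (hQ0 : ∀ t ∈ Ioo 0 T, Q t 0 = 0) (hQ1 : ∀ t ∈ Ioo 0 T, Q t 1 = 0)
    (hA : ∀ y ∈ Ioo (0:ℝ) 1, A ≤ P s y) (hB : ∀ y ∈ Ioo (0:ℝ) 1, P t y ≤ B)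
    (hL : 0 < L) :
    Real.exp (L * s) * A ≤ Real.exp (L * t) * B := by
  by_contra hcon
  push Not at hcon
  set Dl := Real.exp (L * s) * A - Real.exp (L * t) * B with hDl
  have hDpos : 0 < Dl := by linarith
  set η := Dl / (8 * Real.exp (L * t) * (t - s)) with hη
  have hE : 0 < Real.exp (L * t) := Real.exp_pos _
  have hηpos : 0 < η := by
    have : 0 < t - s := by linarith
    positivity
  have hηD : 8 * Real.exp (L * t) * (t - s) * η = Dl := by
    have : t - s ≠ 0 := by linarith
    rw [hη]; field_simp
  have hsub : Icc s t ⊆ Ioo 0 T := fun r hr => ⟨by linarith [hr.1], by linarith [hr.2]⟩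
  obtain ⟨ε, hε0, hε4, hεQ⟩ : ∃ ε, 0 < ε ∧ ε ≤ 1/4 ∧ ∀ r ∈ Icc s t,
      -η ≤ Q r (1 - ε) ∧ Q r ε ≤ η := by
    have huc := (isCompact_Icc.prod isCompact_Icc).uniformContinuousOn_of_continuous
      (hQc.mono (prod_mono hsub subset_rfl))
    rw [Metric.uniformContinuousOn_iff] at huc
    obtain ⟨ρ, hρ, hu⟩ := huc η hηpos
    refine ⟨min (ρ/2) (1/4), by positivity, min_le_right _ _, fun r hr => ?_⟩
    set ε := min (ρ/2) (1/4) with hε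
    have h1 : 0 < ε := by positivity
    have h2 : ε ≤ 1/4 := min_le_right _ _
    have h3 : ε ≤ ρ/2 := min_le_left _ _
    have a1 := hu (r, 1 - ε) ⟨hr, by constructor <;> simp only <;> linarith⟩ (r, 1) ⟨hr, by simp⟩ (by
      rw [Prod.dist_eq]; simp [abs_of_pos h1, hρ]; linarith)
    have a2 := hu (r, ε) ⟨hr, by constructor <;> simp only <;> linarith⟩ (r, 0) ⟨hr, by simp⟩ (by
      rw [Prod.dist_eq]; simp [abs_of_pos h1, hρ]; linarith)
    simp only [hQ0 r (hsub hr), hQ1 r (hsub hr), Real.dist_eq, sub_zero] at a1 a2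
    exact ⟨(abs_lt.1 a1).1.le, (abs_lt.1 a2).2.le⟩
  have hab : ε ≤ 1 - ε := by linarith
  have hI : Icc ε (1 - ε) ⊆ Ioo 0 1 := fun y hy => ⟨by linarith [hy.1], by linarith [hy.2]⟩
  have hslice : ∀ {F : ℝ → ℝ → ℝ},
      ContinuousOn (fun p : ℝ × ℝ => F p.1 p.2) (Ioo 0 T ×ˢ Ioo 0 1) →
      ∀ r ∈ Ioo 0 T, ContinuousOn (F r) (Icc ε (1 - ε)) := by
    intro F hF r hr
    exact hF.comp (f := fun y : ℝ => (r, y)) (by fun_prop) (fun y hy => ⟨hr, hI hy⟩)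
  have hii : ∀ {F : ℝ → ℝ}, ContinuousOn F (Icc ε (1 - ε)) →
      IntervalIntegrable F MeasureTheory.volume ε (1 - ε) := fun hF =>
    ContinuousOn.intervalIntegrable_of_Icc hab hF
  set W : ℝ → ℝ := fun r => ∫ y in ε..(1 - ε), P r y with hW
  have hmeas : ∀ {F : ℝ → ℝ}, ContinuousOn F (Icc ε (1 - ε)) →
      MeasureTheory.AEStronglyMeasurable F
        (MeasureTheory.volume.restrict (uIoc ε (1 - ε))) := by
    intro F hF
    rw [uIoc_of_le hab]
    exact (hF.mono Ioc_subset_Icc_self).aestronglyMeasurable measurableSet_Ioc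
  have hWd : ∀ r ∈ Icc s t, HasDerivAt W (∫ y in ε..(1 - ε), Pt r y) r := by
    intro r hr
    have hr' := hsub hr
    obtain ⟨a, b, hrab, habs⟩ : ∃ a b, r ∈ Ioo a b ∧ Icc a b ⊆ Ioo 0 T :=
      ⟨r / 2, (r + T) / 2, ⟨by linarith [hr'.1], by linarith [hr'.2]⟩,
        fun z hz => ⟨by linarith [hz.1, hr'.1], by linarith [hz.2, hr'.2]⟩⟩
    obtain ⟨C, hC⟩ := (isCompact_Icc.prod isCompact_Icc).exists_bound_of_continuousOn
      (hPtc.mono (prod_mono habs hI))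
    refine (intervalIntegral.hasDerivAt_integral_of_dominated_loc_of_deriv_le
      (F := P) (F' := Pt) (s := Icc a b) (bound := fun _ => C)
      (Icc_mem_nhds hrab.1 hrab.2) ?_ (hii (hslice hPc r hr')) (hmeas (hslice hPtc r hr'))
      ?_ (by simp) ?_).2
    · filter_upwards [Icc_mem_nhds hrab.1 hrab.2] with z hz
      exact hmeas (hslice hPc z (habs hz))
    · refine Eventually.of_forall fun y hy z hz => ?_
      rw [uIoc_of_le hab] at hy
      exact hC (z, y) ⟨hz, Ioc_subset_Icc_self hy⟩
    · refine Eventually.of_forall fun y hy z hz => ?_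
      rw [uIoc_of_le hab] at hy
      exact hP z (habs hz) y (hI (Ioc_subset_Icc_self hy))
  have hWineq : ∀ r ∈ Icc s t, -(2 * η) - L * W r ≤ ∫ y in ε..(1 - ε), Pt r y := by
    intro r hr
    have hr' := hsub hr
    have i1 := hii ((hQyc r hr').mono hI)
    have i2 := hii (hslice hPc r hr')
    have hFTC : ∫ y in ε..(1 - ε), Qy r y = Q r (1 - ε) - Q r ε := by
      refine intervalIntegral.integral_eq_sub_of_hasDerivAt (fun y hy => ?_) i1
      rw [uIcc_of_le hab] at hy
      exact hQ r hr' y (hI hy)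
    have hm := intervalIntegral.integral_mono_on hab (i1.sub (i2.const_mul L))
      (hii (hslice hPtc r hr')) (fun y hy => hineq r hr' y (hI hy))
    rw [intervalIntegral.integral_sub i1 (i2.const_mul L),
      intervalIntegral.integral_const_mul, hFTC] at hm
    have := hεQ r hr
    simp only [hW]
    linarith
  have hmono : MonotoneOn (fun r => Real.exp (L * r) * W r + 2 * η * Real.exp (L * t) * r)
      (Icc s t) := by
    have hd : ∀ r ∈ Icc s t, HasDerivAt
        (fun r => Real.exp (L * r) * W r + 2 * η * Real.exp (L * t) * r)
        (Real.exp (L * r) * (L * 1) * W r + Real.exp (L * r) * (∫ y in ε..(1 - ε), Pt r y)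
          + 2 * η * Real.exp (L * t) * 1) r := by
      intro r hr
      exact ((((hasDerivAt_id r).const_mul L).exp).mul (hWd r hr)).add
        ((hasDerivAt_id r).const_mul _)
    refine monotoneOn_of_deriv_nonneg (convex_Icc s t)
      (fun r hr => (hd r hr).continuousAt.continuousWithinAt)
      (fun r hr => (hd r (interior_subset hr)).differentiableAt.differentiableWithinAt) ?_
    intro r hr
    have hr' := interior_subset hr
    rw [(hd r hr').deriv]
    have h1 := hWineq r hr'
    have h2 : Real.exp (L * r) ≤ Real.exp (L * t) := by
      apply Real.exp_le_exp.2; nlinarith [hr'.2]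
    have h3 := mul_le_mul_of_nonneg_left h1 (Real.exp_pos (L * r)).le
    nlinarith
  have hfin := hmono (left_mem_Icc.2 hst.le) (right_mem_Icc.2 hst.le) hst.le
  simp only at hfin
  have hWs : (1 - 2 * ε) * A ≤ W s := by
    have := intervalIntegral.integral_mono_on hab (by simp)
      (hii (hslice hPc s (hsub (left_mem_Icc.2 hst.le)))) (fun y hy => hA y (hI hy))
    simp only [intervalIntegral.integral_const, smul_eq_mul] at this
    simp only [hW]; linarith
  have hWt : W t ≤ (1 - 2 * ε) * B := by
    have := intervalIntegral.integral_mono_on hab 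
      (hii (hslice hPc t (hsub (right_mem_Icc.2 hst.le)))) (by simp) (fun y hy => hB y (hI hy))
    simp only [intervalIntegral.integral_const, smul_eq_mul] at this
    simp only [hW]; linarith
  have k1 := mul_le_mul_of_nonneg_left hWs (Real.exp_pos (L * s)).le
  have k2 := mul_le_mul_of_nonneg_left hWt hE.le
  have k3 : (1 - 2 * ε) * Dl ≤ 2 * η * Real.exp (L * t) * (t - s) := by
    rw [hDl]; nlinarith
  nlinarith

/-- Chain rule along a curve from continuous partial derivatives. -/
lemma apb_chain {u : ℝ → ℝ → ℝ} {ut ux : ℝ × ℝ → ℝ} {Ω : Set (ℝ × ℝ)} (hΩ : IsOpen Ω)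
    (h1 : ∀ p ∈ Ω, HasDerivAt (fun s => u s p.2) (ut p) p.1)
    (h2 : ∀ p ∈ Ω, HasDerivAt (u p.1) (ux p) p.2)
    (c1 : ContinuousOn ut Ω) (c2 : ContinuousOn ux Ω)
    {t a' : ℝ} {a : ℝ → ℝ} (hp : (t, a t) ∈ Ω) (ha : HasDerivAt a a' t) :
    HasDerivAt (fun s => u s (a s)) (ut (t, a t) + ux (t, a t) * a') t := by
  have hnh : Ω ∈ 𝓝 (t, a t) := hΩ.mem_nhds hp
  have hF := (hasStrictFDerivAt_uncurry_coprod (𝕜 := ℝ) (u := (t, a t)) (f := u)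
    (f₁ := fun s x => ContinuousLinearMap.toSpanSingleton ℝ (ut (s, x)))
    (f₂ := fun s x => ContinuousLinearMap.toSpanSingleton ℝ (ux (s, x)))
    (by filter_upwards [hnh] with p hp using (h1 p hp).hasFDerivAt)
    (by filter_upwards [hnh] with p hp using (h2 p hp).hasFDerivAt)
    (by
      have := (ContinuousLinearMap.toSpanSingletonCLE (𝕜 := ℝ) (E := ℝ)).continuous.continuousAt.comp
        (c1.continuousAt hnh)
      exact this)
    (by
      have := (ContinuousLinearMap.toSpanSingletonCLE (𝕜 := ℝ) (E := ℝ)).continuous.continuousAt.comp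
        (c2.continuousAt hnh)
      exact this)).hasFDerivAt
  have hc : HasDerivAt (fun s => (s, a s)) ((1:ℝ), a') t := (hasDerivAt_id t).prodMk ha
  have := hF.comp_hasDerivAt t hc
  have hval : ut (t, a t) + ux (t, a t) * a' =
      (ContinuousLinearMap.toSpanSingleton ℝ (ut (t, a t))) 1 +
        (ContinuousLinearMap.toSpanSingleton ℝ (ux (t, a t))) a' := by
    simp [mul_comm]
  rw [hval]
  exact this

section
variable {d δ h₀ T M₀ β L mmin mmax : ℝ} {f : ℝ → ℝ → ℝ → ℝ}
    {u₀ : ℝ → ℝ} {u : ℝ → ℝ → ℝ} {g h : ℝ → ℝ}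

lemma apb_upper (hd : 0 < d) (hh₀ : 0 < h₀)
    (hf3 : CondF3 f M₀) (hu₀ : InX δ h₀ u₀)
    (hmax : IsGreatest (u₀ '' Icc (-h₀) h₀) mmax)
    (hδ : 0 < δ)
    (hsol : ClassicalSolution d δ h₀ f u₀ (Ico 0 T) u g h) :
    ∀ t ∈ Ico 0 T, ∀ x ∈ Icc (g t) (h t), u t x < mmax + M₀ := by
  have hδm : δ ≤ mmax := hmax.2 ⟨h₀, ⟨by linarith, le_rfl⟩, hu₀.2.2.1⟩
  have hM := hf3.1
  suffices H : ∀ t ∈ Ico 0 T, ∀ x ∈ Icc (g t) (h t), 0 < (mmax + M₀) - u t x by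
    intro t ht x hx
    linarith [H t ht x hx]
  refine apb_touch (w := fun t x => (mmax + M₀) - u t x) hsol.g_reg.continuousOn
    hsol.h_reg.continuousOn hsol.g_lt_h
    (continuousOn_const.sub hsol.u_cont) ?_ ?_ ?_ ?_
  · intro x hx
    rw [hsol.g_init, hsol.h_init] at hx
    have := hmax.2 ⟨x, hx, rfl⟩
    rw [hsol.u_init x hx]; linarith
  · intro t ht
    rw [hsol.bc_g t ⟨ht.1.le, ht.2⟩ ht.1]; linarith
  · intro t ht
    rw [hsol.bc_h t ⟨ht.1.le, ht.2⟩ ht.1]; linarith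
  · intro t ht x hx hw hy hs
    have ht' : t ∈ Ico 0 T := ⟨ht.1.le, ht.2⟩
    have e1 : deriv (deriv (u t)) x ≤ 0 := by
      refine apb_dd_nonpos ?_ (hsol.ux_diff t ht' ht.1 x ⟨hx.1.le, hx.2.le⟩).continuousAt
      filter_upwards [Ioo_mem_nhds hx.1 hx.2] with y hy'
      linarith [hy y hy']
    have e2 : 0 ≤ deriv (fun s => u s x) t := by
      have := apb_dt (hsol.ut_diff t ht' ht.1 x hx).hasDerivAt.neg (by
        filter_upwards [hs] with s hs'
        simp only [Pi.neg_apply]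
        linarith)
      linarith
    have e3 := hsol.pde t ht' ht.1 x hx
    have e4 := hf3.2 t ht.1.le x (u t x) (by linarith)
    nlinarith

lemma apb_lower (hd : 0 < d) (hh₀ : 0 < h₀) (hL : 0 < L)
    (hf3 : CondF3 f M₀) (hu₀ : InX δ h₀ u₀)
    (hmin : IsLeast (u₀ '' Icc (-h₀) h₀) mmin)
    (hmax : IsGreatest (u₀ '' Icc (-h₀) h₀) mmax)
    (hsol : ClassicalSolution d δ h₀ f u₀ (Ico 0 T) u g h)
    (hLf : ∀ t ∈ Ico (0:ℝ) T, ∀ x : ℝ, ∀ v ∈ Icc (0:ℝ) (mmax + M₀),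
      -(L * v) ≤ f t x v) (hm : 0 < mmin) {ε : ℝ} (hε : 0 < ε) (hε1 : ε < 1) :
    ∀ t ∈ Ico 0 T, ∀ x ∈ Icc (g t) (h t),
      Real.exp (-((L + ε) * t)) * ((1 - ε) * mmin) < u t x := by
  have hmm : mmin ≤ mmax := hmin.2 hmax.1
  have hδm : mmin ≤ δ := hmin.2 ⟨h₀, ⟨by linarith, le_rfl⟩, hu₀.2.2.1⟩
  have hM := hf3.1
  have hzle : ∀ t, 0 ≤ t → Real.exp (-((L + ε) * t)) * ((1 - ε) * mmin) < mmin := by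
    intro t ht
    have h1 : Real.exp (-((L + ε) * t)) ≤ 1 := by
      apply Real.exp_le_one_iff.2
      have : 0 ≤ (L + ε) * t := by positivity
      linarith
    have h2 : 0 < (1 - ε) * mmin := mul_pos (by linarith) hm
    nlinarith
  suffices H : ∀ t ∈ Ico 0 T, ∀ x ∈ Icc (g t) (h t),
      0 < u t x - Real.exp (-((L + ε) * t)) * ((1 - ε) * mmin) by
    intro t ht x hx
    linarith [H t ht x hx]
  refine apb_touch (w := fun t x => u t x - Real.exp (-((L + ε) * t)) * ((1 - ε) * mmin))
    hsol.g_reg.continuousOn hsol.h_reg.continuousOn hsol.g_lt_h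
    (hsol.u_cont.sub (by fun_prop)) ?_ ?_ ?_ ?_
  · intro x hx
    rw [hsol.g_init, hsol.h_init] at hx
    have := hmin.2 ⟨x, hx, rfl⟩
    have := hzle 0 le_rfl
    rw [hsol.u_init x hx]; linarith
  · intro t ht
    have := hzle t ht.1.le
    rw [hsol.bc_g t ⟨ht.1.le, ht.2⟩ ht.1]; linarith
  · intro t ht
    have := hzle t ht.1.le
    rw [hsol.bc_h t ⟨ht.1.le, ht.2⟩ ht.1]; linarith
  · intro t ht x hx hw hy hs
    have ht' : t ∈ Ico 0 T := ⟨ht.1.le, ht.2⟩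
    have e1 : 0 ≤ deriv (deriv (u t)) x := by
      refine apb_dd_nonneg ?_ (hsol.ux_diff t ht' ht.1 x ⟨hx.1.le, hx.2.le⟩).continuousAt
      filter_upwards [Ioo_mem_nhds hx.1 hx.2] with y hy'
      linarith [hy y hy']
    have hz := hzle t ht.1.le
    have hzp : 0 < Real.exp (-((L + ε) * t)) * ((1 - ε) * mmin) :=
      mul_pos (Real.exp_pos _) (mul_pos (by linarith) hm)
    have e2 := apb_dt ((hsol.ut_diff t ht' ht.1 x hx).hasDerivAt.sub
      ((((hasDerivAt_id t).const_mul (L + ε)).neg.exp).mul_const ((1 - ε) * mmin))) (by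
        filter_upwards [hs] with s hs'
        simp only [Pi.sub_apply, Pi.neg_apply, id]
        linarith)
    simp only [Pi.neg_apply, id] at e2
    have e3 := hsol.pde t ht' ht.1 x hx
    have e4 := hLf t ht' x (u t x) ⟨by linarith, by linarith⟩
    have hwe : u t x = Real.exp (-((L + ε) * t)) * ((1 - ε) * mmin) := by linarith
    rw [← hwe] at hzp
    have e5 : deriv (fun s => u s x) t + (L + ε) * u t x ≤ 0 := by
      rw [hwe]; linarith
    nlinarith [mul_nonneg hd.le e1, mul_pos hε hzp]

lemma apb_range (hδ : 0 < δ) (hL : 0 < L)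
    (hsol : ClassicalSolution d δ h₀ f u₀ (Ico 0 T) u g h)
    {C m : ℝ} (hlow : ∀ t ∈ Ioo 0 T, ∀ x ∈ Icc (g t) (h t), Real.exp (-(L * t)) * m ≤ u t x)
    (hup : ∀ t ∈ Ioo 0 T, ∀ x ∈ Icc (g t) (h t), u t x ≤ C)
    (hf : ∀ t ∈ Ioo 0 T, ∀ x ∈ Icc (g t) (h t), -(L * u t x) ≤ f t x (u t x))
    {s t : ℝ} (hs : 0 < s) (hst : s < t) (htT : t < T) :
    (h s - g s) * m ≤ Real.exp (L * t) * ((h t - g t) * C) := by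
  have hI : Ioo 0 T ⊆ Ico 0 T := Ioo_subset_Ico_self
  have gc : ContDiffOn ℝ 1 g (Ioo 0 T) := hsol.g_reg.mono hI
  have hc : ContDiffOn ℝ 1 h (Ioo 0 T) := hsol.h_reg.mono hI
  have gd : ∀ t ∈ Ioo 0 T, HasDerivAt g (deriv g t) t := fun t ht =>
    ((gc.differentiableOn one_ne_zero).differentiableAt (Ioo_mem_nhds ht.1 ht.2)).hasDerivAt
  have hdv : ∀ t ∈ Ioo 0 T, HasDerivAt h (deriv h t) t := fun t ht =>
    ((hc.differentiableOn one_ne_zero).differentiableAt (Ioo_mem_nhds ht.1 ht.2)).hasDerivAt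
  have gdc : ContinuousOn (deriv g) (Ioo 0 T) := gc.continuousOn_deriv_of_isOpen isOpen_Ioo le_rfl
  have hdc : ContinuousOn (deriv h) (Ioo 0 T) := hc.continuousOn_deriv_of_isOpen isOpen_Ioo le_rfl
  have hpos : ∀ t ∈ Ioo 0 T, 0 < h t - g t := fun t ht => sub_pos.2 (hsol.g_lt_h t (hI ht))
  set X : ℝ → ℝ → ℝ := fun t y => g t + y * (h t - g t) with hX
  set Xt : ℝ → ℝ → ℝ := fun t y => deriv g t + y * (deriv h t - deriv g t) with hXt
  have hXo : ∀ t ∈ Ioo 0 T, ∀ y ∈ Ioo (0:ℝ) 1, X t y ∈ Ioo (g t) (h t) := by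
    intro t ht y hy
    have := hpos t ht
    constructor <;> simp only [hX] <;> nlinarith [hy.1, hy.2]
  have hXcl : ∀ t ∈ Ioo 0 T, ∀ y ∈ Icc (0:ℝ) 1, X t y ∈ Icc (g t) (h t) := by
    intro t ht y hy
    have := hpos t ht
    constructor <;> simp only [hX] <;> nlinarith [hy.1, hy.2]
  set Ω : Set (ℝ × ℝ) := {p | p.1 ∈ Ioo 0 T ∧ p.2 ∈ Ioo (g p.1) (h p.1)} with hΩ
  have hΩo : IsOpen Ω := by
    rw [isOpen_iff_mem_nhds]
    rintro ⟨t, x⟩ ⟨ht, hx⟩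
    have n1 : ∀ᶠ p : ℝ × ℝ in 𝓝 (t, x), p.1 ∈ Ioo 0 T :=
      continuousAt_fst.eventually (Ioo_mem_nhds ht.1 ht.2)
    have n2 : ∀ᶠ p : ℝ × ℝ in 𝓝 (t, x), g p.1 < p.2 :=
      ((gd t ht).continuousAt.comp (f := Prod.fst) (x := (t, x)) continuousAt_fst).eventually_lt
        continuousAt_snd hx.1
    have n3 : ∀ᶠ p : ℝ × ℝ in 𝓝 (t, x), p.2 < h p.1 :=
      continuousAt_snd.eventually_lt
        ((hdv t ht).continuousAt.comp (f := Prod.fst) (x := (t, x)) continuousAt_fst) hx.2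
    filter_upwards [n1, n2, n3] with p h1 h2 h3
    exact ⟨h1, h2, h3⟩
  have uc : ContinuousOn (fun p : ℝ × ℝ => u p.1 p.2)
      {p : ℝ × ℝ | p.1 ∈ Ioo 0 T ∧ p.2 ∈ Icc (g p.1) (h p.1)} :=
    hsol.u_cont.mono fun p hp => ⟨hI hp.1, hp.2⟩
  have uxc : ContinuousOn (fun p : ℝ × ℝ => deriv (u p.1) p.2)
      {p : ℝ × ℝ | p.1 ∈ Ioo 0 T ∧ p.2 ∈ Icc (g p.1) (h p.1)} :=
    hsol.ux_cont.mono fun p hp => ⟨hI hp.1, hp.1.1, hp.2⟩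
  have utc : ContinuousOn (fun p : ℝ × ℝ => deriv (fun s => u s p.2) p.1) Ω :=
    hsol.ut_cont.mono fun p hp => ⟨hI hp.1, hp.1.1, hp.2⟩
  have uxxc : ContinuousOn (fun p : ℝ × ℝ => deriv (deriv (u p.1)) p.2) Ω :=
    hsol.uxx_cont.mono fun p hp => ⟨hI hp.1, hp.1.1, hp.2⟩
  have hΩs : Ω ⊆ {p : ℝ × ℝ | p.1 ∈ Ioo 0 T ∧ p.2 ∈ Icc (g p.1) (h p.1)} :=
    fun p hp => ⟨hp.1, hp.2.1.le, hp.2.2.le⟩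
  have lift : ∀ {φ : ℝ → ℝ} (S : Set ℝ), ContinuousOn φ (Ioo 0 T) →
      ContinuousOn (fun p : ℝ × ℝ => φ p.1) (Ioo 0 T ×ˢ S) := fun S hφ =>
    hφ.comp continuousOn_fst (fun p hp => hp.1)
  have cX : ∀ S : Set ℝ, ContinuousOn (fun p : ℝ × ℝ => (p.1, X p.1 p.2)) (Ioo 0 T ×ˢ S) := fun S =>
    continuousOn_fst.prodMk ((lift S gc.continuousOn).add
      (continuousOn_snd.mul ((lift S hc.continuousOn).sub (lift S gc.continuousOn))))
  have cXt : ∀ S : Set ℝ, ContinuousOn (fun p : ℝ × ℝ => Xt p.1 p.2) (Ioo 0 T ×ˢ S) := fun S =>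
    (lift S gdc).add (continuousOn_snd.mul ((lift S hdc).sub (lift S gdc)))
  have cw : ∀ S : Set ℝ, ContinuousOn (fun p : ℝ × ℝ => h p.1 - g p.1) (Ioo 0 T ×ˢ S) := fun S =>
    (lift S hc.continuousOn).sub (lift S gc.continuousOn)
  have cwd : ∀ S : Set ℝ, ContinuousOn (fun p : ℝ × ℝ => deriv h p.1 - deriv g p.1)
    (Ioo 0 T ×ˢ S) := fun S => (lift S hdc).sub (lift S gdc)
  have cu : ContinuousOn (fun p : ℝ × ℝ => u p.1 (X p.1 p.2)) (Ioo 0 T ×ˢ Icc 0 1) :=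
    uc.comp (cX _) (fun p hp => ⟨hp.1, hXcl p.1 hp.1 p.2 hp.2⟩)
  have cux : ContinuousOn (fun p : ℝ × ℝ => deriv (u p.1) (X p.1 p.2)) (Ioo 0 T ×ˢ Icc 0 1) :=
    uxc.comp (cX _) (fun p hp => ⟨hp.1, hXcl p.1 hp.1 p.2 hp.2⟩)
  have cut : ContinuousOn (fun p : ℝ × ℝ => deriv (fun s => u s (X p.1 p.2)) p.1)
      (Ioo 0 T ×ˢ Ioo 0 1) :=
    utc.comp (cX _) (fun p hp => ⟨hp.1, hXo p.1 hp.1 p.2 hp.2⟩)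
  have cuxx : ContinuousOn (fun p : ℝ × ℝ => deriv (deriv (u p.1)) (X p.1 p.2))
      (Ioo 0 T ×ˢ Ioo 0 1) :=
    uxxc.comp (cX _) (fun p hp => ⟨hp.1, hXo p.1 hp.1 p.2 hp.2⟩)
  have hss : (Ioo 0 T ×ˢ Ioo (0:ℝ) 1) ⊆ Ioo 0 T ×ˢ Icc 0 1 :=
    prod_mono subset_rfl Ioo_subset_Icc_self
  have cu' := cu.mono hss
  have cux' := cux.mono hss
  have key := apb_mass (T := T) (L := L) (s := s) (t := t)
    (A := (h s - g s) * (Real.exp (-(L * s)) * m)) (B := (h t - g t) * C)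
    (P := fun t y => (h t - g t) * u t (X t y))
    (Pt := fun t y => (deriv h t - deriv g t) * u t (X t y) +
      (h t - g t) * (deriv (fun s => u s (X t y)) t + deriv (u t) (X t y) * Xt t y))
    (Q := fun t y => u t (X t y) * Xt t y + d * deriv (u t) (X t y))
    (Qy := fun t y => (deriv (u t) (X t y) * (h t - g t)) * Xt t y
      + u t (X t y) * (deriv h t - deriv g t)
      + d * (deriv (deriv (u t)) (X t y) * (h t - g t)))
    hs hst htT ?_ ?_ ?_ ?_ ?_ ?_ ?_ ?_ ?_ ?_ ?_ hL
  · have he : Real.exp (L * s) * Real.exp (-(L * s)) = 1 := by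
      rw [← Real.exp_add]; simp
    calc (h s - g s) * m = Real.exp (L * s) * ((h s - g s) * (Real.exp (-(L * s)) * m)) := by
          linear_combination (-(h s - g s) * m) * he
      _ ≤ _ := key
  · intro t ht y hy
    have hXd : HasDerivAt (fun s => X s y) (Xt t y) t :=
      (gd t ht).add (((hdv t ht).sub (gd t ht)).const_mul y)
    have hch := apb_chain (u := u) (a := fun s => X s y) hΩo
      (fun p hp => (hsol.ut_diff p.1 (hI hp.1) hp.1.1 p.2 hp.2).hasDerivAt)
      (fun p hp => (hsol.ux_diff p.1 (hI hp.1) hp.1.1 p.2 (hΩs hp).2).hasDerivAt)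
      utc (uxc.mono hΩs) (show (t, X t y) ∈ Ω from ⟨ht, hXo t ht y hy⟩) hXd
    exact ((hdv t ht).sub (gd t ht)).mul hch
  · exact (cw _).mul cu'
  · exact ((cwd _).mul cu').add ((cw _).mul (cut.add (cux'.mul (cXt _))))
  · intro t ht y hy
    have hXy : HasDerivAt (X t) (h t - g t) y := by
      have := ((hasDerivAt_id y).mul_const (h t - g t)).const_add (g t)
      simpa [hX] using this
    have hXty : HasDerivAt (Xt t) (deriv h t - deriv g t) y := by
      have := ((hasDerivAt_id y).mul_const (deriv h t - deriv g t)).const_add (deriv g t)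
      simpa [hXt] using this
    have d1 := (hsol.ux_diff t (hI ht) ht.1 _ (hXcl t ht y ⟨hy.1.le, hy.2.le⟩)).hasDerivAt.comp y hXy
    have d2 := (hsol.uxx_diff t (hI ht) ht.1 _ (hXo t ht y hy)).hasDerivAt.comp y hXy
    exact (d1.mul hXty).add (d2.const_mul d)
  · intro t ht
    have := (((cux'.mul (cw _)).mul (cXt _)).add (cu'.mul (cwd _))).add
      (continuousOn_const (c := d) |>.mul (cuxx.mul (cw _)))
    exact this.comp (f := fun y : ℝ => (t, y)) (by fun_prop) (fun y hy => ⟨ht, hy⟩)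
  · intro t ht y hy
    have e1 := hsol.pde t (hI ht) ht.1 _ (hXo t ht y hy)
    have e2 := hf t ht _ (hXcl t ht y ⟨hy.1.le, hy.2.le⟩)
    have e3 := mul_le_mul_of_nonneg_left e2 (hpos t ht).le
    simp only [e1]
    nlinarith
  · exact (cu.mul (cXt _)).add (continuousOn_const.mul cux)
  · intro t ht
    have e1 := hsol.bc_g t (hI ht) ht.1
    have e2 := hsol.stefan_g t (hI ht) ht.1
    simp only [hX, hXt, zero_mul, add_zero, e1, e2]
    field_simp
    ring
  · intro t ht
    have e1 := hsol.bc_h t (hI ht) ht.1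
    have e2 := hsol.stefan_h t (hI ht) ht.1
    simp only [hX, hXt, one_mul, add_sub_cancel, e1, e2]
    field_simp
    ring
  · intro y hy
    have hs' : s ∈ Ioo 0 T := ⟨hs, hst.trans htT⟩
    exact mul_le_mul_of_nonneg_left (hlow s hs' _ (hXcl s hs' y ⟨hy.1.le, hy.2.le⟩)) (hpos s hs').le
  · intro y hy
    have ht' : t ∈ Ioo 0 T := ⟨hs.trans hst, htT⟩
    exact mul_le_mul_of_nonneg_left (hup t ht' _ (hXcl t ht' y ⟨hy.1.le, hy.2.le⟩)) (hpos t ht').le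

end

/-- a priori bounds on the solution and the range size (Lemma 3.4). -/
theorem a_priori_bounds (d δ h₀ T M₀ β L mmin mmax : ℝ) (f : ℝ → ℝ → ℝ → ℝ)
    (u₀ : ℝ → ℝ) (u : ℝ → ℝ → ℝ) (g h : ℝ → ℝ)
    (hd : 0 < d) (hδ : 0 < δ) (hh₀ : 0 < h₀) (hT : 0 < T)
    (hf2 : CondF2 f β) (hf3 : CondF3 f M₀)
    (hu₀ : InX δ h₀ u₀)
    (hmin : IsLeast (u₀ '' Icc (-h₀) h₀) mmin)
    (hmax : IsGreatest (u₀ '' Icc (-h₀) h₀) mmax)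
    (hsol : ClassicalSolution d δ h₀ f u₀ (Ico 0 T) u g h)
    (hL : 0 < L)
    (hLf : ∀ t ∈ Ico (0:ℝ) T, ∀ x : ℝ, ∀ v ∈ Icc (0:ℝ) (mmax + M₀),
      -(L * v) ≤ f t x v) :
    (∀ t ∈ Ioo (0:ℝ) T, ∀ x ∈ Icc (g t) (h t),
      Real.exp (-(L * t)) * mmin ≤ u t x ∧ u t x ≤ mmax + M₀ ∧
      2 * h₀ / (mmax + M₀) * Real.exp (-(L * t)) * mmin ≤ h t - g t) ∧
    ∃ C₁ > 0, ∃ C₃ > 0, ∀ t ∈ Ioo (0:ℝ) T, ∀ x ∈ Icc (g t) (h t),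
      C₁ ≤ u t x ∧ C₃ ≤ h t - g t := by
  have hmpos : 0 < mmin := by
    obtain ⟨x, hx, rfl⟩ := hmin.1
    exact hu₀.2.2.2 x hx
  have hmm : mmin ≤ mmax := hmin.2 hmax.1
  have hM := hf3.1
  have hC : 0 < mmax + M₀ := by linarith
  have hI : Ioo 0 T ⊆ Ico 0 T := Ioo_subset_Ico_self
  have hup : ∀ t ∈ Ioo 0 T, ∀ x ∈ Icc (g t) (h t), u t x ≤ mmax + M₀ := fun t ht x hx =>
    (apb_upper hd hh₀ hf3 hu₀ hmax hδ hsol t (hI ht) x hx).le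
  have hlow : ∀ t ∈ Ioo 0 T, ∀ x ∈ Icc (g t) (h t), Real.exp (-(L * t)) * mmin ≤ u t x := by
    intro t ht x hx
    have hlim : Tendsto (fun ε : ℝ => Real.exp (-((L + ε) * t)) * ((1 - ε) * mmin)) (𝓝[>] 0)
        (𝓝 (Real.exp (-((L + 0) * t)) * ((1 - 0) * mmin))) :=
      (Continuous.tendsto (by fun_prop) 0).mono_left nhdsWithin_le_nhds
    simp only [add_zero, sub_zero, one_mul] at hlim
    refine le_of_tendsto hlim ?_
    filter_upwards [Ioo_mem_nhdsGT (show (0:ℝ) < 1 by norm_num)] with ε hε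
    exact (apb_lower hd hh₀ hL hf3 hu₀ hmin hmax hsol hLf hmpos hε.1 hε.2 t (hI ht) x hx).le
  have hff : ∀ t ∈ Ioo 0 T, ∀ x ∈ Icc (g t) (h t), -(L * u t x) ≤ f t x (u t x) :=
    fun t ht x hx => hLf t (hI ht) x _
      ⟨(mul_pos (Real.exp_pos _) hmpos).le.trans (hlow t ht x hx), hup t ht x hx⟩
  have hrange : ∀ t ∈ Ioo 0 T,
      2 * h₀ / (mmax + M₀) * Real.exp (-(L * t)) * mmin ≤ h t - g t := by
    intro t ht
    have h0 : (0:ℝ) ∈ Ico 0 T := ⟨le_rfl, hT⟩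
    have hle : 𝓝[>] (0:ℝ) ≤ 𝓝[Ico 0 T] 0 := by
      refine nhdsWithin_le_iff.2 ?_
      filter_upwards [Ioo_mem_nhdsGT hT] with s hs using hI hs
    have hg := (hsol.g_reg.continuousOn 0 h0).tendsto.mono_left hle
    have hh := (hsol.h_reg.continuousOn 0 h0).tendsto.mono_left hle
    have hlim := (hh.sub hg).mul_const mmin
    have hfin : (h 0 - g 0) * mmin ≤ Real.exp (L * t) * ((h t - g t) * (mmax + M₀)) := by
      refine le_of_tendsto hlim ?_
      filter_upwards [Ioo_mem_nhdsGT ht.1] with s hs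
      exact apb_range hδ hL hsol hlow hup hff hs.1 hs.2 ht.2
    rw [hsol.g_init, hsol.h_init] at hfin
    have he : Real.exp (-(L * t)) * Real.exp (L * t) = 1 := by
      rw [← Real.exp_add]; simp
    have h2 := mul_le_mul_of_nonneg_left hfin (Real.exp_pos (-(L * t))).le
    rw [← mul_assoc _ (Real.exp (L * t)), he, one_mul] at h2
    rw [div_mul_eq_mul_div, div_mul_eq_mul_div, div_le_iff₀ hC]
    linarith
  refine ⟨fun t ht x hx => ⟨hlow t ht x hx, hup t ht x hx, hrange t ht⟩,
    Real.exp (-(L * T)) * mmin, by positivity,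
    2 * h₀ / (mmax + M₀) * Real.exp (-(L * T)) * mmin, by positivity, fun t ht x hx => ?_⟩
  have hexp : Real.exp (-(L * T)) ≤ Real.exp (-(L * t)) := by
    apply Real.exp_le_exp.2; nlinarith [ht.2]
  refine ⟨le_trans ?_ (hlow t ht x hx), le_trans ?_ (hrange t ht)⟩
  · gcongr
  · gcongr
end
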